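/- arXiv:1607.03798 — 14 statements merged into one kernel-verified Lean document; each statement's English description precedes it below -/
import Mathlib

section
/- Let Ω be a set, let G ≤ Sym(Ω) be a semiprimitive permutation group, and let N be an intransitive normal subgroup of G. Then the kernel of the induced action of G on the set Δ of N-orbits is exactly N, the induced faithful action of G/N on Δ is semiprimitive, and for any ω ∈ Ω, writing δ ∈ Δ for the N-orbit containing ω, the point-stabiliser (G/N)_δ is isomorphic to G_ω. -/
open Pointwise

def IsTransitiveOn {G : Type*} [Group G] (N : Subgroup G) (Ω : Type*) [MulAction G Ω] : Prop :=
  ∀ a b : Ω, ∃ n ∈ N, n • a = b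

def IsSemiregularOn {G : Type*} [Group G] (N : Subgroup G) (Ω : Type*) [MulAction G Ω] : Prop :=
  ∀ n ∈ N, (∃ a : Ω, n • a = a) → n = 1

def IsSemiprimitive (G Ω : Type*) [Group G] [MulAction G Ω] : Prop :=
  IsTransitiveOn (⊤ : Subgroup G) Ω ∧
    ∀ N : Subgroup G, N.Normal → IsTransitiveOn N Ω ∨ IsSemiregularOn N Ω

def IsPlinth {G : Type*} [Group G] (K : Subgroup G) (Ω : Type*) [MulAction G Ω] : Prop :=
  K.Normal ∧ IsTransitiveOn K Ω ∧
    ∀ N : Subgroup G, N.Normal → N < K → ¬ IsTransitiveOn N Ω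

/-- If `R` is semiregular, a subgroup `N ≤ R` contains every element of `R` that maps some point
into its own `N`-orbit. -/
theorem IsSemiregularOn.mem_of_smul_mem_orbit {G Ω : Type*} [Group G] [MulAction G Ω]
    {N R : Subgroup G} (hR : IsSemiregularOn R Ω) (hNR : N ≤ R) {r : G} (hr : r ∈ R) {ω : Ω}
    (h : r • ω ∈ MulAction.orbit N ω) : r ∈ N := by
  obtain ⟨⟨n, hn⟩, hnω : n • ω = r • ω⟩ := h
  have hone : n⁻¹ * r = 1 :=
    hR _ (R.mul_mem (R.inv_mem (hNR hn)) hr) ⟨ω, by rw [mul_smul, ← hnω, inv_smul_smul]⟩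
  rwa [← inv_mul_eq_one.mp hone]

/-- The kernel of the action of `G` on the set of orbits of a subgroup `N`. -/
def orbitKernel {G : Type*} [Group G] (N : Subgroup G) (Ω : Type*) [MulAction G Ω] :
    Subgroup G :=
  ⨅ ω : Ω, MulAction.stabilizer G (MulAction.orbit N ω : Set Ω)

theorem mem_orbitKernel {G Ω : Type*} [Group G] [MulAction G Ω] {N : Subgroup G} {g : G} :
    g ∈ orbitKernel N Ω ↔
      ∀ ω : Ω, g • (MulAction.orbit N ω : Set Ω) = MulAction.orbit N ω := by
  simp [orbitKernel, Subgroup.mem_iInf, MulAction.mem_stabilizer_iff]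

theorem orbitKernel_normal {G Ω : Type*} [Group G] [MulAction G Ω] (N : Subgroup G) [N.Normal] :
    (orbitKernel N Ω).Normal where
  conj_mem g hg h := by
    rw [mem_orbitKernel] at hg ⊢
    intro ω
    rw [mul_smul, mul_smul, MulAction.smul_orbit_eq_orbit_smul N ω h⁻¹, hg,
      MulAction.smul_orbit_eq_orbit_smul, smul_inv_smul]

theorem smul_mem_orbit_of_smul_orbit_eq {G Ω : Type*} [Group G] [MulAction G Ω]
    {N : Subgroup G} {g : G} {ω : Ω}
    (h : g • (MulAction.orbit N ω : Set Ω) = MulAction.orbit N ω) :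
    g • ω ∈ MulAction.orbit N ω :=
  h ▸ Set.smul_mem_smul_set (MulAction.mem_orbit_self ω)

theorem smul_orbit_eq_of_mem {G Ω : Type*} [Group G] [MulAction G Ω] {N : Subgroup G}
    {n : G} (hn : n ∈ N) (ω : Ω) :
    n • (MulAction.orbit N ω : Set Ω) = MulAction.orbit N ω :=
  MulAction.smul_orbit (⟨n, hn⟩ : N) ω

theorem le_orbitKernel {G Ω : Type*} [Group G] [MulAction G Ω] (N : Subgroup G) :
    N ≤ orbitKernel N Ω :=
  fun _ hn => mem_orbitKernel.mpr (smul_orbit_eq_of_mem hn)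

theorem not_isTransitiveOn_orbitKernel {G Ω : Type*} [Group G] [MulAction G Ω] {N : Subgroup G}
    (hN : ¬ IsTransitiveOn N Ω) : ¬ IsTransitiveOn (orbitKernel N Ω) Ω := by
  refine fun h => hN fun a b => ?_
  obtain ⟨k, hk, rfl⟩ := h a b
  obtain ⟨n, hn⟩ := smul_mem_orbit_of_smul_orbit_eq (mem_orbitKernel.mp hk a)
  exact ⟨n, n.2, hn⟩

/-- A point-stabiliser is isomorphic to the stabiliser of the corresponding orbit of a
semiregular normal subgroup `N`, modulo `N`. -/
theorem IsSemiregularOn.nonempty_stabilizer_orbit_quotient_mulEquiv {G Ω : Type*} [Group G]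
    [MulAction G Ω] {N : Subgroup G} [N.Normal] (hN : IsSemiregularOn N Ω) (ω : Ω) :
    Nonempty
      ((↥(MulAction.stabilizer G (MulAction.orbit N ω : Set Ω)) ⧸
          N.subgroupOf (MulAction.stabilizer G (MulAction.orbit N ω : Set Ω))) ≃*
        ↥(MulAction.stabilizer G ω)) := by
  set S := MulAction.stabilizer G (MulAction.orbit N ω : Set Ω) with hS
  have hle : MulAction.stabilizer G ω ≤ S := fun g hg => by
    rw [hS, MulAction.mem_stabilizer_iff, MulAction.smul_orbit_eq_orbit_smul,
      MulAction.mem_stabilizer_iff.mp hg]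
  let f := (QuotientGroup.mk' (N.subgroupOf S)).comp (Subgroup.inclusion hle)
  refine ⟨(MulEquiv.ofBijective f ⟨?_, ?_⟩).symm⟩
  · rw [injective_iff_map_eq_one]
    intro g hg
    have hgN : (g : G) ∈ N :=
      Subgroup.mem_subgroupOf.mp ((QuotientGroup.eq_one_iff (Subgroup.inclusion hle g)).mp hg)
    exact Subtype.ext (hN g hgN ⟨ω, g.2⟩)
  · intro q
    obtain ⟨⟨s, hs⟩, rfl⟩ := QuotientGroup.mk_surjective q
    obtain ⟨⟨n, hn⟩, hnω : n • ω = s • ω⟩ :=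
      smul_mem_orbit_of_smul_orbit_eq (MulAction.mem_stabilizer_iff.mp hs)
    refine ⟨⟨n⁻¹ * s, ?_⟩, QuotientGroup.eq.mpr ?_⟩
    · rw [MulAction.mem_stabilizer_iff, mul_smul, ← hnω, inv_smul_smul]
    · rw [Subgroup.mem_subgroupOf]
      simpa [mul_assoc] using ‹N.Normal›.conj_mem n hn s⁻¹

/-- If `G ≤ Sym(Ω)` is semiprimitive and `N` is an intransitive normal subgroup, then the
kernel of the action of `G` on the set of `N`-orbits is exactly `N`, the induced action of
`G/N` on the set of `N`-orbits is (transitive, faithful and) semiprimitive, and the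
point-stabiliser of the `N`-orbit of `ω` in `G/N` is isomorphic to `G_ω`. -/
theorem stmt0 {G Ω : Type*} [Group G] [MulAction G Ω] [FaithfulSMul G Ω]
    (hG : IsSemiprimitive G Ω) (N : Subgroup G) [hN : N.Normal]
    (hNintrans : ¬ IsTransitiveOn N Ω) :
    -- the kernel of the action of G on the set of N-orbits is exactly N
    (∀ g : G, (∀ ω : Ω, g • (MulAction.orbit N ω : Set Ω) = MulAction.orbit N ω) ↔ g ∈ N) ∧
    -- G/N is transitive on the set of N-orbits
    (∀ ω ω' : Ω, ∃ g : G, g • ω ∈ MulAction.orbit N ω') ∧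
    -- G/N is semiprimitive on the set of N-orbits: every normal subgroup (i.e. R/N with
    -- N ≤ R ⊴ G) is transitive on the orbits or semiregular on the orbits
    (∀ R : Subgroup G, R.Normal → N ≤ R →
      (∀ ω ω' : Ω, ∃ r ∈ R, r • ω ∈ MulAction.orbit N ω') ∨
      (∀ r ∈ R, (∃ ω : Ω, r • ω ∈ MulAction.orbit N ω) → r ∈ N)) ∧
    -- the point-stabiliser of the N-orbit δ of ω in G/N is isomorphic to G_ω
    (∀ ω : Ω,
      Nonempty
        ((↥(MulAction.stabilizer G (MulAction.orbit N ω : Set Ω)) ⧸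
            N.subgroupOf (MulAction.stabilizer G (MulAction.orbit N ω : Set Ω))) ≃*
          ↥(MulAction.stabilizer G ω))) := by
  have hNreg : IsSemiregularOn N Ω := (hG.2 N hN).resolve_left hNintrans
  have hKreg : IsSemiregularOn (orbitKernel N Ω) Ω :=
    (hG.2 _ (orbitKernel_normal N)).resolve_left (not_isTransitiveOn_orbitKernel hNintrans)
  refine ⟨fun g => ⟨fun h => ?_, smul_orbit_eq_of_mem⟩, fun ω ω' => ?_, fun R hR hNR => ?_,
    hNreg.nonempty_stabilizer_orbit_quotient_mulEquiv⟩
  · have : Nonempty Ω := by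
      by_contra hempty
      exact hNintrans fun a => (hempty ⟨a⟩).elim
    obtain ⟨ω⟩ := this
    exact hKreg.mem_of_smul_mem_orbit (le_orbitKernel N) (mem_orbitKernel.mpr h)
      (smul_mem_orbit_of_smul_orbit_eq (h ω))
  · obtain ⟨g, -, rfl⟩ := hG.1 ω ω'
    exact ⟨g, MulAction.mem_orbit_self _⟩
  · refine (hG.2 R hR).imp (fun htrans ω ω' => ?_) fun hreg r hr ⟨ω, hω⟩ =>
      hreg.mem_of_smul_mem_orbit hNR hr hω
    obtain ⟨r, hr, rfl⟩ := htrans ω ω'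
    exact ⟨r, hr, MulAction.mem_orbit_self _⟩
end

section
/- Let G ≤ Sym(Ω) be a semiprimitive permutation group, let ω ∈ Ω, and let R be a non-trivial normal subgroup of the point-stabiliser G_ω. Then the commutator subgroup [G,R] is a transitive normal subgroup of G. -/
open Pointwise

/-- The commutator subgroup `[G, H]` is normal in `G`, whether or not `H` is. -/
theorem commutator_top_left_normal {G : Type*} [Group G] (H : Subgroup G) :
    (⁅(⊤ : Subgroup G), H⁆).Normal :=
  Subgroup.normalizer_eq_top_iff.mp
    (top_le_iff.mp (Subgroup.normalizer_commutator_ge_left ⊤ H))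

open scoped commutatorElement in
/-- The subgroup `[G, H] H` is normal in `G`. -/
theorem commutator_top_left_sup_normal {G : Type*} [Group G] (H : Subgroup G) :
    (⁅(⊤ : Subgroup G), H⁆ ⊔ H).Normal := by
  have hN := commutator_top_left_normal H
  refine ⟨fun x hx g => ?_⟩
  obtain ⟨n, hn, r, hr, rfl⟩ := Subgroup.mem_sup_of_normal_left.mp hx
  have key : g * (n * r) * g⁻¹ = (g * n * g⁻¹ * ⁅g, r⁆) * r := by
    simp only [commutatorElement_def]
    group
  rw [key]
  exact Subgroup.mul_mem_sup (mul_mem (hN.conj_mem n hn g)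
    (Subgroup.commutator_mem_commutator (Subgroup.mem_top _) hr)) hr

/-- A subgroup whose orbit of one point is everything is transitive. -/
theorem isTransitiveOn_of_forall_exists_smul_eq {G Ω : Type*} [Group G] [MulAction G Ω]
    {N : Subgroup G} {ω : Ω} (h : ∀ a : Ω, ∃ n ∈ N, n • ω = a) : IsTransitiveOn N Ω := by
  intro a b
  obtain ⟨m, hm, rfl⟩ := h a
  obtain ⟨n, hn, rfl⟩ := h b
  exact ⟨n * m⁻¹, mul_mem hn (inv_mem hm), by simp [mul_smul]⟩

/-- If `G ≤ Sym(Ω)` is semiprimitive, `ω ∈ Ω` and `R` is a non-trivial normal subgroup of the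
point-stabiliser `G_ω`, then `[G,R]` is a transitive normal subgroup of `G`. -/
theorem stmt1 {G Ω : Type*} [Group G] [MulAction G Ω] [FaithfulSMul G Ω]
    (hG : IsSemiprimitive G Ω) (ω : Ω)
    (R : Subgroup ↥(MulAction.stabilizer G ω)) (hR : R.Normal) (hRnt : R ≠ ⊥) :
    (⁅(⊤ : Subgroup G), R.map (MulAction.stabilizer G ω).subtype⁆).Normal ∧
      IsTransitiveOn ⁅(⊤ : Subgroup G), R.map (MulAction.stabilizer G ω).subtype⁆ Ω := by
  set H := R.map (MulAction.stabilizer G ω).subtype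
  have hfix : ∀ r ∈ H, r • ω = ω := by
    rintro _ ⟨r, -, rfl⟩
    exact r.2
  have hN := commutator_top_left_normal H
  refine ⟨hN, isTransitiveOn_of_forall_exists_smul_eq (ω := ω) fun a => ?_⟩
  rcases hG.2 _ (commutator_top_left_sup_normal H) with htrans | hsemi
  · obtain ⟨x, hx, rfl⟩ := htrans ω a
    obtain ⟨n, hn, r, hr, rfl⟩ := Subgroup.mem_sup_of_normal_left.mp hx
    exact ⟨n, hn, by rw [mul_smul, hfix r hr]⟩
  · refine absurd ((Subgroup.eq_bot_iff_forall R).mpr fun r hr => Subtype.ext ?_) hRnt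
    have hr' : (r : G) ∈ H := Subgroup.mem_map_of_mem _ hr
    exact hsemi r (Subgroup.mem_sup_right hr') ⟨ω, hfix r hr'⟩
end

section
/- Let G be a group with a normal subgroup K and a core-free subgroup H such that G = KH and [K,N] = K for every non-trivial normal subgroup N of H. Then the action of G by right multiplication on the set of right cosets of H in G is faithful and semiprimitive. -/
open Pointwise

/-- A normal subgroup `K` with `G = KH` is transitive on the cosets of `H`. -/
theorem isTransitiveOn_quotient_of_factorization {G : Type*} [Group G] {K H : Subgroup G}
    (hK : K.Normal) (hKH : ∀ g : G, ∃ k ∈ K, ∃ h ∈ H, g = k * h) :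
    IsTransitiveOn K (G ⧸ H) := by
  intro a b
  induction a using QuotientGroup.induction_on with | H x => ?_
  induction b using QuotientGroup.induction_on with | H y => ?_
  obtain ⟨k, hk, h, hh, e⟩ := hKH (x⁻¹ * y)
  refine ⟨x * k * x⁻¹, hK.conj_mem k hk x, ?_⟩
  rw [MulAction.Quotient.smul_coe, smul_eq_mul, QuotientGroup.eq]
  have hy : y = x * (k * h) := by rw [← e]; group
  rw [hy]
  convert hh using 1
  group

/-- A normal subgroup meeting `H` trivially is semiregular on the cosets of `H`. -/
theorem isSemiregularOn_quotient_of_disjoint {G : Type*} [Group G] {N H : Subgroup G}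
    (hN : N.Normal) (hd : Disjoint N H) : IsSemiregularOn N (G ⧸ H) := by
  rintro n hn ⟨a, ha⟩
  induction a using QuotientGroup.induction_on with | H x => ?_
  rw [MulAction.Quotient.smul_coe, smul_eq_mul, eq_comm, QuotientGroup.eq, ← mul_assoc] at ha
  have hconj : x⁻¹ * n * x ∈ N := by simpa using hN.conj_mem n hn x⁻¹
  have h1 := Subgroup.disjoint_def.mp hd hconj ha
  simpa using (conj_eq_one_iff (a := x⁻¹) (b := n)).mp (by simpa using h1)

/-- The action on the cosets of a core-free subgroup is faithful. -/
theorem faithfulSMul_quotient_of_normalCore_eq_bot {G : Type*} [Group G] {H : Subgroup G}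
    (hH : H.normalCore = ⊥) : FaithfulSMul G (G ⧸ H) := by
  rw [Subgroup.normalCore_eq_ker, MonoidHom.ker_eq_bot_iff] at hH
  exact ⟨fun h => hH (Equiv.ext h)⟩

/-- If `G` is a group with a normal subgroup `K` and a core-free subgroup `H` such that
`G = KH` and `[K,N] = K` for every non-trivial normal subgroup `N` of `H`, then the action
of `G` on the coset space of `H` is faithful and semiprimitive. -/
theorem stmt2 {G : Type*} [Group G] (K H : Subgroup G) (hK : K.Normal)
    (hHcf : H.normalCore = ⊥)
    (hKH : ∀ g : G, ∃ k ∈ K, ∃ h ∈ H, g = k * h)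
    (hcomm : ∀ N : Subgroup ↥H, N.Normal → N ≠ ⊥ → ⁅K, N.map H.subtype⁆ = K) :
    FaithfulSMul G (G ⧸ H) ∧ IsSemiprimitive G (G ⧸ H) := by
  have hKt := isTransitiveOn_quotient_of_factorization hK hKH
  refine ⟨faithfulSMul_quotient_of_normalCore_eq_bot hHcf, fun a b => ?_, fun N hN => ?_⟩
  · obtain ⟨k, -, hk⟩ := hKt a b
    exact ⟨k, Subgroup.mem_top k, hk⟩
  by_cases hbot : N.subgroupOf H = ⊥
  · exact .inr (isSemiregularOn_quotient_of_disjoint hN (Subgroup.subgroupOf_eq_bot.mp hbot))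
  · have hle : K ≤ N := by
      rw [← hcomm (N.subgroupOf H) (hN.subgroupOf H) hbot]
      exact (Subgroup.commutator_mono le_rfl (Subgroup.map_comap_le _ _)).trans
        (Subgroup.commutator_le_right K N)
    refine .inl fun a b => ?_
    obtain ⟨k, hk, e⟩ := hKt a b
    exact ⟨k, hle hk, e⟩
end

section
/- Let G ≤ Sym(Ω) be a semiprimitive permutation group with plinth K, and let M be an intransitive normal subgroup of G. Let Δ be the set of M-orbits, let Ḡ = G/M act (faithfully) on Δ, and let K̄ = KM/M ≤ Ḡ. Then: (a) if M ≤ K, then K̄ is a plinth of Ḡ; (b) if K is non-regular, then K̄ is non-regular on Δ; (c) if K is regular, then K̄ is regular on Δ if and only if M ≤ K; (d) if every transitive normal subgroup of G contains K, then K is the unique plinth of G and K̄ is the unique plinth of Ḡ. -/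
open Pointwise

/-- `R` (modulo `M`) is transitive on the set of `M`-orbits. -/
def TransOnOrbits {G : Type*} [Group G] (Ω : Type*) [MulAction G Ω] (R M : Subgroup G) : Prop :=
  ∀ ω ω' : Ω, ∃ r ∈ R, r • ω ∈ MulAction.orbit M ω'

/-- `R` (modulo `M`) is semiregular on the set of `M`-orbits. -/
def SemiregOnOrbits {G : Type*} [Group G] (Ω : Type*) [MulAction G Ω] (R M : Subgroup G) : Prop :=
  ∀ r ∈ R, (∃ ω : Ω, r • ω ∈ MulAction.orbit M ω) → r ∈ M

/-- A subgroup containing `M` that is transitive on the `M`-orbits is transitive. -/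
theorem TransOnOrbits.isTransitiveOn {G Ω : Type*} [Group G] [MulAction G Ω] {R M : Subgroup G}
    (h : TransOnOrbits Ω R M) (hMR : M ≤ R) : IsTransitiveOn R Ω := by
  intro a b
  obtain ⟨r, hr, ⟨m, hm⟩, hmr⟩ := h a b
  have hmr' : m • b = r • a := hmr
  exact ⟨m⁻¹ * r, R.mul_mem (R.inv_mem (hMR hm)) hr, by rw [mul_smul, ← hmr', inv_smul_smul]⟩

theorem IsTransitiveOn.transOnOrbits {G Ω : Type*} [Group G] [MulAction G Ω] {R : Subgroup G}
    (h : IsTransitiveOn R Ω) (M : Subgroup G) : TransOnOrbits Ω R M := by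
  intro a b
  obtain ⟨r, hr, hab⟩ := h a b
  exact ⟨r, hr, hab ▸ MulAction.mem_orbit_self _⟩

theorem IsTransitiveOn.mono {G Ω : Type*} [Group G] [MulAction G Ω] {R S : Subgroup G}
    (h : IsTransitiveOn R Ω) (hRS : R ≤ S) : IsTransitiveOn S Ω := by
  intro a b
  obtain ⟨r, hr, hab⟩ := h a b
  exact ⟨r, hRS hr, hab⟩

/-- In a semiregular subgroup, elements agreeing at a point are equal. -/
theorem IsSemiregularOn.eq_of_smul_eq {G Ω : Type*} [Group G] [MulAction G Ω] {N : Subgroup G}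
    (h : IsSemiregularOn N Ω) {x y : G} (hx : x ∈ N) (hy : y ∈ N) {a : Ω}
    (hxy : x • a = y • a) : x = y := by
  have := h (x⁻¹ * y) (N.mul_mem (N.inv_mem hx) hy) ⟨a, by rw [mul_smul, ← hxy, inv_smul_smul]⟩
  exact inv_mul_eq_one.mp this

/-- Let `G ≤ Sym(Ω)` be semiprimitive with plinth `K`, let `M` be an intransitive normal
subgroup and consider the faithful action of `Ḡ = G/M` on the set `Δ` of `M`-orbits, with
`K̄ = KM/M`.  Then: (a) if `M ≤ K` then `K̄` is a plinth of `Ḡ`; (b) if `K` is non-regular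
then `K̄` is non-regular on `Δ`; (c) if `K` is regular then `K̄` is regular on `Δ` iff
`M ≤ K`; (d) if every transitive normal subgroup of `G` contains `K`, then `K` is the unique
plinth of `G` and `K̄` is the unique plinth of `Ḡ`.  (Normal subgroups of `Ḡ` are identified
with normal subgroups `R` of `G` with `M ≤ R`, and `K̄` with `K ⊔ M`.) -/
theorem stmt6 {G Ω : Type*} [Group G] [MulAction G Ω] [FaithfulSMul G Ω]
    (hG : IsSemiprimitive G Ω) (K : Subgroup G) (hK : IsPlinth K Ω)
    (M : Subgroup G) (hM : M.Normal) (hMintrans : ¬ IsTransitiveOn M Ω) :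
    -- (a)
    (M ≤ K →
      (TransOnOrbits Ω (K ⊔ M) M ∧
        ∀ R : Subgroup G, R.Normal → M ≤ R → R < K ⊔ M → ¬ TransOnOrbits Ω R M)) ∧
    -- (b)
    ((∃ ω : Ω, ∃ k ∈ K, k ≠ 1 ∧ k • ω = ω) → ¬ SemiregOnOrbits Ω (K ⊔ M) M) ∧
    -- (c)
    ((IsTransitiveOn K Ω ∧ IsSemiregularOn K Ω) →
      ((TransOnOrbits Ω (K ⊔ M) M ∧ SemiregOnOrbits Ω (K ⊔ M) M) ↔ M ≤ K)) ∧
    -- (d)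
    ((∀ T : Subgroup G, T.Normal → IsTransitiveOn T Ω → K ≤ T) →
      ((∀ L : Subgroup G, IsPlinth L Ω → L = K) ∧
        (TransOnOrbits Ω (K ⊔ M) M ∧
          ∀ R : Subgroup G, R.Normal → M ≤ R → R < K ⊔ M → ¬ TransOnOrbits Ω R M) ∧
        ∀ R : Subgroup G, R.Normal → M ≤ R →
          (TransOnOrbits Ω R M ∧
            ∀ R' : Subgroup G, R'.Normal → M ≤ R' → R' < R → ¬ TransOnOrbits Ω R' M) →
          R = K ⊔ M)) := by
  obtain ⟨hKn, hKt, hKmin⟩ := hK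
  have hMs : IsSemiregularOn M Ω := (hG.2 M hM).resolve_left hMintrans
  have hKM : TransOnOrbits Ω (K ⊔ M) M := (hKt.mono le_sup_left).transOnOrbits M
  refine ⟨fun hMK => ⟨hKM, fun R hR hMR hlt hRt => ?_⟩, ?_, ?_, fun hmin => ⟨?_, ⟨hKM, ?_⟩, ?_⟩⟩
  · rw [sup_eq_left.mpr hMK] at hlt
    exact hKmin R hR hlt (hRt.isTransitiveOn hMR)
  · rintro ⟨ω, k, hk, hk1, hkω⟩ hs
    have hkM : k ∈ M :=
      hs k (Subgroup.mem_sup_left hk) ⟨ω, hkω.symm ▸ MulAction.mem_orbit_self ω⟩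
    exact hk1 (hMs k hkM ⟨ω, hkω⟩)
  · rintro ⟨-, hKs⟩
    refine ⟨fun ⟨_, hs⟩ m hm => ?_, fun hMK => ⟨hKM, ?_⟩⟩
    · obtain ⟨ω⟩ : Nonempty Ω := by
        by_contra hne
        exact hMintrans fun a => (hne ⟨a⟩).elim
      obtain ⟨k, hk, hkω⟩ := hKt ω (m • ω)
      have hkM : k ∈ M := hs k (Subgroup.mem_sup_left hk) ⟨ω, ⟨m, hm⟩, hkω.symm⟩
      exact hMs.eq_of_smul_eq hkM hm hkω ▸ hk
    · rw [sup_eq_left.mpr hMK]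
      rintro r hr ⟨ω, ⟨m, hm⟩, hmr⟩
      exact hKs.eq_of_smul_eq (hMK hm) hr hmr ▸ hm
  · rintro L ⟨hLn, hLt, hLmin⟩
    by_contra hne
    exact hLmin K hKn ((hmin L hLn hLt).lt_of_ne (Ne.symm hne)) hKt
  · exact fun R hR hMR hlt hRt =>
      hlt.not_ge (sup_le (hmin R hR (hRt.isTransitiveOn hMR)) hMR)
  · rintro R hR hMR ⟨hRt, hRmin⟩
    by_contra hne
    have hle : K ⊔ M ≤ R := sup_le (hmin R hR (hRt.isTransitiveOn hMR)) hMR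
    exact hRmin (K ⊔ M) inferInstance le_sup_right (hle.lt_of_ne (Ne.symm hne)) hKM
end

section
/- Let G ≤ Sym(Ω) be a semiprimitive permutation group having at least two plinths. Then there is a characteristically simple group X such that for every pair of distinct plinths L and R of G, the induced faithful action of G/(L∩R) on the set of (L∩R)-orbits is primitive, and L/(L∩R) ≅ X ≅ R/(L∩R). -/
open Pointwise

/-- A group is characteristically simple if it is non-trivial and its only characteristic
subgroups are trivial. -/
def IsCharSimple (X : Type*) [Group X] : Prop :=
  Nontrivial X ∧ ∀ H : Subgroup X, H.Characteristic → H = ⊥ ∨ H = ⊤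

/-- `HasFactor L N X` says that `L / (L ⊓ N)` is isomorphic to `X`. -/
def HasFactor {G : Type*} [Group G] (L N : Subgroup G) (X : Type*) [Group X] : Prop :=
  ∃ φ : ↥L →* X, Function.Surjective φ ∧ ∀ x : ↥L, φ x = 1 ↔ (x : G) ∈ N

namespace HasFactor

variable {G : Type*} [Group G] {L R N M : Subgroup G} {X : Type*} [Group X]

theorem congr_right (h : HasFactor L N X) (hNM : ∀ x ∈ L, x ∈ N ↔ x ∈ M) :
    HasFactor L M X := by
  obtain ⟨φ, hφ, hk⟩ := h
  exact ⟨φ, hφ, fun x => (hk x).trans (hNM x x.2)⟩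

/-- A subgroup `W` of `G × G` inducing a bijection between `L / (L ⊓ N)` and `R / (R ⊓ M)`
transports quotients. -/
theorem transfer (W : Subgroup (G × G)) (h : HasFactor L N X)
    (hR : ∀ r ∈ R, ∃ l ∈ L, (l, r) ∈ W) (hL : ∀ l ∈ L, ∃ r ∈ R, (l, r) ∈ W)
    (hW : ∀ l ∈ L, ∀ r ∈ R, (l, r) ∈ W → (l ∈ N ↔ r ∈ M)) :
    HasFactor R M X := by
  obtain ⟨φ, hφ, hk⟩ := h
  choose f hfL hfW using hR
  have unique : ∀ (r : G) (hr : r ∈ R) (l : ↥L), ((l : G), r) ∈ W → φ ⟨f r hr, hfL r hr⟩ = φ l := by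
    intro r hr l hl
    rw [← mul_inv_eq_one, ← map_inv, ← map_mul, hk]
    refine (hW _ (Subtype.prop _) 1 (one_mem _) ?_).2 (one_mem _)
    simpa using W.mul_mem (hfW r hr) (W.inv_mem hl)
  refine ⟨MonoidHom.mk' (fun r => φ ⟨f r r.2, hfL r r.2⟩) ?_, ?_, ?_⟩
  · intro a b
    rw [← map_mul]
    exact unique _ _ _ (W.mul_mem (hfW a a.2) (hfW b b.2))
  · intro x
    obtain ⟨l, rfl⟩ := hφ x
    obtain ⟨r, hr, hlr⟩ := hL l l.2
    exact ⟨⟨r, hr⟩, unique r hr l hlr⟩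
  · intro r
    exact (hk _).trans (hW _ (hfL r r.2) r r.2 (hfW r r.2))

/-- The subgroup of pairs of elements congruent modulo `N`. -/
def congruentPairs (N : Subgroup G) [N.Normal] : Subgroup (G × G) :=
  MonoidHom.eqLocus ((QuotientGroup.mk' N).comp (MonoidHom.fst G G))
    ((QuotientGroup.mk' N).comp (MonoidHom.snd G G))

theorem mem_congruentPairs [N.Normal] {a b : G} : (a, b) ∈ congruentPairs N ↔ a⁻¹ * b ∈ N :=
  QuotientGroup.eq

theorem mem_iff_of_mem_congruentPairs [N.Normal] {a b : G} (h : (a, b) ∈ congruentPairs N) :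
    a ∈ N ↔ b ∈ N := by
  rw [mem_congruentPairs] at h
  refine ⟨fun ha => by simpa using N.mul_mem ha h, fun hb => ?_⟩
  simpa using N.mul_mem hb (N.inv_mem h)

theorem sup_iff [N.Normal] : HasFactor (L ⊔ N) N X ↔ HasFactor L N X := by
  have hsup : ∀ x ∈ L ⊔ N, ∃ l ∈ L, l⁻¹ * x ∈ N := by
    intro x hx
    obtain ⟨l, hl, n, hn, rfl⟩ := Subgroup.mem_sup_of_normal_right.1 hx
    exact ⟨l, hl, by simpa using hn⟩
  have hsup' : ∀ x ∈ L ⊔ N, ∃ l ∈ L, x⁻¹ * l ∈ N := by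
    intro x hx
    obtain ⟨l, hl, h⟩ := hsup x hx
    exact ⟨l, hl, by simpa using N.inv_mem h⟩
  have hself : ∀ l ∈ L, ∃ x ∈ L ⊔ N, x⁻¹ * l ∈ N := fun l hl =>
    ⟨l, Subgroup.mem_sup_left hl, by simp⟩
  have hself' : ∀ l ∈ L, ∃ x ∈ L ⊔ N, l⁻¹ * x ∈ N := fun l hl =>
    ⟨l, Subgroup.mem_sup_left hl, by simp⟩
  simp only [← mem_congruentPairs] at *
  exact ⟨fun h => h.transfer (congruentPairs N) hself hsup'
      fun _ _ _ _ => mem_iff_of_mem_congruentPairs,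
    fun h => h.transfer (congruentPairs N) hsup hself'
      fun _ _ _ _ => mem_iff_of_mem_congruentPairs⟩

end HasFactor

/-- The elements of `G` fixing every class of the `G`-invariant equivalence relation `s`. -/
def classKernel {G Ω : Type*} [Group G] [MulAction G Ω] (s : Setoid Ω)
    (hs : ∀ (g : G) (a b : Ω), s a b → s (g • a) (g • b)) : Subgroup G where
  carrier := {g | ∀ a : Ω, s a (g • a)}
  one_mem' a := by simp
  mul_mem' {g h} hg hh a := by
    rw [mul_smul]
    exact s.trans (hg a) (hs g _ _ (hh a))
  inv_mem' {g} hg a := by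
    have h := hg (g⁻¹ • a)
    rw [smul_inv_smul] at h
    exact s.symm h

theorem classKernel_normal {G Ω : Type*} [Group G] [MulAction G Ω] (s : Setoid Ω)
    (hs : ∀ (g : G) (a b : Ω), s a b → s (g • a) (g • b)) : (classKernel s hs).Normal := by
  refine ⟨fun k hk g a => ?_⟩
  have h := hs g _ _ (hk (g⁻¹ • a))
  rwa [smul_inv_smul, ← mul_smul, ← mul_smul] at h

/-- The equivalence relation whose classes are the orbits of the subgroup `M`. -/
def orbitSetoid {G : Type*} [Group G] (M : Subgroup G) (Ω : Type*) [MulAction G Ω] : Setoid Ω where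
  r a b := ∃ m ∈ M, m • a = b
  iseqv := {
    refl a := ⟨1, M.one_mem, one_smul _ _⟩
    symm := by
      rintro a b ⟨m, hm, rfl⟩
      exact ⟨m⁻¹, M.inv_mem hm, inv_smul_smul _ _⟩
    trans := by
      rintro a b c ⟨m, hm, rfl⟩ ⟨k, hk, rfl⟩
      exact ⟨k * m, M.mul_mem hk hm, mul_smul _ _ _⟩ }

theorem orbitSetoid_smul {G : Type*} [Group G] {M : Subgroup G} (hM : M.Normal) {Ω : Type*}
    [MulAction G Ω] (g : G) (a b : Ω) (h : orbitSetoid M Ω a b) :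
    orbitSetoid M Ω (g • a) (g • b) := by
  obtain ⟨m, hm, rfl⟩ := h
  exact ⟨g * m * g⁻¹, hM.conj_mem m hm g, by simp [mul_smul]⟩

namespace IsPlinth

variable {G Ω : Type*} [Group G] [MulAction G Ω] {L R S : Subgroup G}

theorem eq_of_le (hL : IsPlinth L Ω) (hR : IsPlinth R Ω) (h : L ≤ R) : L = R := by
  by_contra hne
  exact hR.2.2 L hL.1 (lt_of_le_of_ne h hne) hL.2.1

theorem inf_lt (hL : IsPlinth L Ω) (hR : IsPlinth R Ω) (hne : L ≠ R) : L ⊓ R < L :=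
  lt_of_le_of_ne inf_le_left fun h => hne (hL.eq_of_le hR (inf_eq_left.1 h))

theorem inf_normal (hL : IsPlinth L Ω) (hR : IsPlinth R Ω) : (L ⊓ R).Normal :=
  ⟨fun n hn g => ⟨hL.1.conj_mem n hn.1 g, hR.1.conj_mem n hn.2 g⟩⟩

theorem not_transitive_inf (hL : IsPlinth L Ω) (hR : IsPlinth R Ω) (hne : L ≠ R) :
    ¬ IsTransitiveOn (L ⊓ R) Ω :=
  hL.2.2 _ (hL.inf_normal hR) (hL.inf_lt hR hne)

theorem commutator_mem (hL : IsPlinth L Ω) (hR : IsPlinth R Ω) {l r : G} (hl : l ∈ L)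
    (hr : r ∈ R) : r⁻¹ * l * r * l⁻¹ ∈ L ⊓ R := by
  constructor
  · exact L.mul_mem (by simpa using hL.1.conj_mem l hl r⁻¹) (L.inv_mem hl)
  · have h := R.mul_mem (R.inv_mem hr) (hR.1.conj_mem r hr l)
    change r⁻¹ * l * r * l⁻¹ ∈ R
    simpa only [mul_assoc] using h

/-- An element of `L` fixing one class of an invariant relation coarser than the orbits of
`L ⊓ R` fixes them all. -/
theorem mem_classKernel (hL : IsPlinth L Ω) (hR : IsPlinth R Ω) (s : Setoid Ω)
    (hs : ∀ (g : G) (a b : Ω), s a b → s (g • a) (g • b))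
    (hN : ∀ n ∈ L ⊓ R, ∀ a, s a (n • a)) {l : G} (hl : l ∈ L) {a : Ω} (ha : s a (l • a)) :
    l ∈ classKernel s hs := by
  intro b
  obtain ⟨r, hr, rfl⟩ := hR.2.1 a b
  have h := hs r _ _ (s.trans ha (hN _ (hL.commutator_mem hR hl hr) (l • a)))
  simpa [← mul_smul, mul_assoc] using h

theorem classKernel_semiregular (hG : IsSemiprimitive G Ω) (s : Setoid Ω)
    (hs : ∀ (g : G) (a b : Ω), s a b → s (g • a) (g • b)) (htop : ¬ ∀ a b, s a b) :
    IsSemiregularOn (classKernel s hs) Ω := by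
  refine (hG.2 _ (classKernel_normal s hs)).resolve_left fun h => htop fun a b => ?_
  obtain ⟨k, hk, rfl⟩ := h a b
  exact hk a

/-- A proper invariant relation coarser than the orbits of `L ⊓ R` is the orbit relation. -/
theorem exists_inf_smul_eq (hG : IsSemiprimitive G Ω) (hL : IsPlinth L Ω) (hR : IsPlinth R Ω)
    (s : Setoid Ω) (hs : ∀ (g : G) (a b : Ω), s a b → s (g • a) (g • b))
    (hN : ∀ n ∈ L ⊓ R, ∀ a, s a (n • a)) (htop : ¬ ∀ a b, s a b) {a b : Ω} (hab : s a b) :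
    ∃ n ∈ L ⊓ R, n • a = b := by
  obtain ⟨l, hl, hla⟩ := hL.2.1 a b
  obtain ⟨r, hr, hra⟩ := hR.2.1 a b
  have hlK := hL.mem_classKernel hR s hs hN hl (a := a) (by rwa [hla])
  have hrK := hR.mem_classKernel hL s hs (by rwa [inf_comm]) hr (a := a) (by rwa [hra])
  have h : r⁻¹ * l = 1 := classKernel_semiregular hG s hs htop _
    (mul_mem (inv_mem hrK) hlK) ⟨a, by rw [mul_smul, hla, ← hra, inv_smul_smul]⟩
  obtain rfl : r = l := inv_mul_eq_one.1 h
  exact ⟨r, ⟨hl, hr⟩, hla⟩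

/-- `L / (L ⊓ R)` is semiregular on the orbits of `L ⊓ R`. -/
theorem mem_inf_of_smul_eq (hG : IsSemiprimitive G Ω) (hL : IsPlinth L Ω) (hR : IsPlinth R Ω)
    (hne : L ≠ R) {l : G} (hl : l ∈ L) {a : Ω} (ha : ∃ n ∈ L ⊓ R, n • a = l • a) :
    l ∈ L ⊓ R := by
  have hs := orbitSetoid_smul (hL.inf_normal hR) (Ω := Ω)
  have hN : ∀ n ∈ L ⊓ R, ∀ a, orbitSetoid (L ⊓ R) Ω a (n • a) := fun n hn a => ⟨n, hn, rfl⟩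
  have hlK := hL.mem_classKernel hR _ hs hN hl ha
  obtain ⟨n, hn, hna⟩ := ha
  have h : n⁻¹ * l = 1 := classKernel_semiregular hG _ hs (hL.not_transitive_inf hR hne) _
    (mul_mem (inv_mem (hN n hn)) hlK) ⟨a, by rw [mul_smul, ← hna, inv_smul_smul]⟩
  obtain rfl : n = l := inv_mul_eq_one.1 h
  exact hn

theorem eq_inf_or_eq (hG : IsSemiprimitive G Ω) (hL : IsPlinth L Ω) (hR : IsPlinth R Ω)
    (hne : L ≠ R) {M : Subgroup G} (hM : M.Normal) (hNM : L ⊓ R ≤ M) (hML : M ≤ L) :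
    M = L ⊓ R ∨ M = L := by
  by_cases ht : IsTransitiveOn M Ω
  · right
    by_contra h
    exact hL.2.2 M hM (lt_of_le_of_ne hML h) ht
  · left
    refine le_antisymm (fun m hm => ?_) hNM
    obtain ⟨a⟩ : Nonempty Ω := by
      by_contra h
      exact ht fun a => (h ⟨a⟩).elim
    exact hL.mem_inf_of_smul_eq hG hR hne (hML hm) (a := a)
      (hL.exists_inf_smul_eq hG hR (orbitSetoid M Ω) (orbitSetoid_smul hM)
        (fun n hn a => ⟨n, hNM hn, rfl⟩) ht ⟨m, hm, rfl⟩)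

/-- The pairs `(l, r)` such that `l * r` fixes the `L ⊓ R`-orbit of `a`; modulo `L ⊓ R` this is
the graph of an isomorphism. -/
def pairing (hL : IsPlinth L Ω) (hR : IsPlinth R Ω) (a : Ω) : Subgroup (G × G) where
  carrier := {p | p.1 ∈ L ∧ p.2 ∈ R ∧ p.1 * p.2 ∈ (L ⊓ R) ⊔ MulAction.stabilizer G a}
  one_mem' := ⟨L.one_mem, R.one_mem, by simp⟩
  mul_mem' := by
    rintro ⟨l, r⟩ ⟨l', r'⟩ ⟨hl, hr, h⟩ ⟨hl', hr', h'⟩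
    refine ⟨mul_mem hl hl', mul_mem hr hr', ?_⟩
    have hc := hL.commutator_mem hR hl' hr
    have hc' := Subgroup.mem_sup_left (T := MulAction.stabilizer G a) hc
    have e := mul_mem (mul_mem h hc') h'
    simpa [mul_assoc] using e
  inv_mem' := by
    rintro ⟨l, r⟩ ⟨hl, hr, h⟩
    refine ⟨inv_mem hl, inv_mem hr, ?_⟩
    have hc := inv_mem (hL.commutator_mem hR hl (inv_mem hr))
    have hc' := Subgroup.mem_sup_left (T := MulAction.stabilizer G a) hc
    have e := mul_mem (inv_mem h) hc'
    simpa [mul_assoc] using e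

theorem hasFactor_symm (hG : IsSemiprimitive G Ω) (hL : IsPlinth L Ω) (hR : IsPlinth R Ω)
    (hne : L ≠ R) {X : Type*} [Group X] (h : HasFactor L R X) : HasFactor R L X := by
  obtain ⟨a⟩ : Nonempty Ω := by
    by_contra h
    exact hL.not_transitive_inf hR hne fun a => (h ⟨a⟩).elim
  have := hL.inf_normal hR
  refine h.transfer (hL.pairing hR a) (fun r hr => ?_) (fun l hl => ?_) ?_
  · obtain ⟨l, hl, hla⟩ := hL.2.1 (r • a) a
    exact ⟨l, hl, hl, hr, Subgroup.mem_sup_right (by simpa [mul_smul] using hla)⟩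
  · obtain ⟨r, hr, hra⟩ := hR.2.1 a (l⁻¹ • a)
    exact ⟨r, hr, hl, hr, Subgroup.mem_sup_right (by simp [mul_smul, hra])⟩
  · rintro l hl r hr ⟨-, -, hlr⟩
    obtain ⟨n, hn, g, hg, hng⟩ := Subgroup.mem_sup_of_normal_left.1 hlr
    have hna : n • a = l • r • a := by
      have hga : g • a = a := hg
      have h2 := congrArg (· • a) hng
      simpa [mul_smul, hga] using h2
    constructor
    · intro hlN
      refine (hR.mem_inf_of_smul_eq hG hL hne.symm hr (a := a) ⟨l⁻¹ * n, ?_, ?_⟩).2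
      · rw [inf_comm]
        exact mul_mem (inv_mem ⟨hl, hlN⟩) hn
      · rw [mul_smul, hna, inv_smul_smul]
    · intro hrN
      refine (hL.mem_inf_of_smul_eq hG hR hne hl (a := r • a) ⟨n * r⁻¹, ?_, ?_⟩).2
      · exact mul_mem hn (inv_mem ⟨hrN, hr⟩)
      · rw [mul_smul, inv_smul_smul, hna]

/-- Distinct intersections with a common plinth generate it. -/
theorem inf_sup_inf (hG : IsSemiprimitive G Ω) (hL : IsPlinth L Ω) (hR : IsPlinth R Ω)
    (hS : IsPlinth S Ω) (hLR : L ≠ R) (hLS : L ≠ S) (hne : L ⊓ R ≠ L ⊓ S) :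
    (L ⊓ R) ⊔ (L ⊓ S) = L := by
  have := hL.inf_normal hR
  have := hL.inf_normal hS
  have hle : (L ⊓ R) ⊔ (L ⊓ S) ≤ L := sup_le inf_le_left inf_le_left
  have hn : ((L ⊓ R) ⊔ (L ⊓ S)).Normal := inferInstance
  rcases hL.eq_inf_or_eq hG hR hLR hn le_sup_left hle with h | h
  · rcases hL.eq_inf_or_eq hG hS hLS hn le_sup_right hle with h' | h'
    · exact absurd (h.symm.trans h') hne
    · exact h'
  · exact h

theorem inf_eq_of_le (hG : IsSemiprimitive G Ω) (hL : IsPlinth L Ω) (hR : IsPlinth R Ω)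
    (hS : IsPlinth S Ω) (hLR : L ≠ R) (hLS : L ≠ S) (hle : L ⊓ R ≤ S) :
    L ⊓ R = L ⊓ S := by
  refine ((hL.eq_inf_or_eq hG hR hLR (hL.inf_normal hS) (le_inf inf_le_left hle)
    inf_le_left).resolve_right (hL.inf_lt hS hLS).ne).symm

theorem hasFactor_change (hG : IsSemiprimitive G Ω) (hL : IsPlinth L Ω) (hR : IsPlinth R Ω)
    (hS : IsPlinth S Ω) (hLR : L ≠ R) (hLS : L ≠ S) {X : Type*} [Group X]
    (h : HasFactor L R X) : HasFactor L S X := by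
  by_cases hAB : L ⊓ R = L ⊓ S
  · refine h.congr_right fun x hx => ?_
    have := SetLike.ext_iff.1 hAB x
    simpa [Subgroup.mem_inf, hx] using this
  have hRS : R ≠ S := by
    rintro rfl
    exact hAB rfl
  have hR' : (R ⊓ S) ⊔ (R ⊓ L) = R := by
    refine hR.inf_sup_inf hG hS hL hRS hLR.symm fun e => hAB ?_
    refine hL.inf_eq_of_le hG hR hS hLR hLS ?_
    rw [inf_comm, ← e]
    exact inf_le_right
  have hS' : (R ⊓ S) ⊔ (S ⊓ L) = S := by
    rw [inf_comm R S]
    refine hS.inf_sup_inf hG hR hL hRS.symm hLS.symm fun e => hAB ?_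
    refine (hL.inf_eq_of_le hG hS hR hLS hLR ?_).symm
    rw [inf_comm L S, ← e]
    exact inf_le_right
  have := hR.inf_normal hL
  have := hS.inf_normal hL
  have hRL : HasFactor R (R ⊓ L) X :=
    (hL.hasFactor_symm hG hR hLR h).congr_right fun x hx => by simp [Subgroup.mem_inf, hx]
  have hRL' : HasFactor ((R ⊓ S) ⊔ (R ⊓ L)) (R ⊓ L) X := by rwa [hR']
  have hC : HasFactor (R ⊓ S) (S ⊓ L) X :=
    (HasFactor.sup_iff.1 hRL').congr_right fun x hx => by
      simp [Subgroup.mem_inf, (Subgroup.mem_inf.1 hx).1, (Subgroup.mem_inf.1 hx).2]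
  have hSL := HasFactor.sup_iff.2 hC
  rw [hS'] at hSL
  exact hS.hasFactor_symm hG hL hLS.symm
    (hSL.congr_right fun x hx => by simp [Subgroup.mem_inf, hx])

theorem hasFactor_quotient [R.Normal] : HasFactor L R (↥L ⧸ R.subgroupOf L) :=
  ⟨QuotientGroup.mk' _, QuotientGroup.mk'_surjective _, fun x => by
    rw [QuotientGroup.mk'_apply, QuotientGroup.eq_one_iff, Subgroup.mem_subgroupOf]⟩

/-- The preimage in `G` of a characteristic subgroup of a quotient of normal subgroups is normal. -/
theorem map_comap_mk_normal [L.Normal] [R.Normal] (H : Subgroup (↥L ⧸ R.subgroupOf L))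
    (hH : H.Characteristic) :
    ((H.comap (QuotientGroup.mk' (R.subgroupOf L))).map L.subtype).Normal := by
  refine ⟨?_⟩
  rintro _ ⟨l, hl, rfl⟩ g
  have he : (R.subgroupOf L).map (MulAut.conjNormal g : MulAut ↥L).toMonoidHom =
      R.subgroupOf L := by
    ext x
    rw [Subgroup.mem_map_equiv, Subgroup.mem_subgroupOf, Subgroup.mem_subgroupOf,
      MulAut.conjNormal_symm_apply]
    constructor
    · intro hx
      have h := Subgroup.Normal.conj_mem ‹R.Normal› _ hx g
      simpa [mul_assoc] using h
    · intro hx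
      have h := Subgroup.Normal.conj_mem ‹R.Normal› _ hx g⁻¹
      simpa using h
  let e := QuotientGroup.congr (R.subgroupOf L) (R.subgroupOf L) (MulAut.conjNormal g) he
  refine ⟨MulAut.conjNormal g l, ?_, MulAut.conjNormal_apply g l⟩
  have hfix := hH.fixed e
  have hl' : QuotientGroup.mk' (R.subgroupOf L) l ∈ H.comap e.toMonoidHom := by
    rw [hfix]
    exact hl
  exact hl'

theorem isCharSimple_quotient (hG : IsSemiprimitive G Ω) (hL : IsPlinth L Ω)
    (hR : IsPlinth R Ω) (hne : L ≠ R) [L.Normal] [R.Normal] :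
    IsCharSimple (↥L ⧸ R.subgroupOf L) := by
  constructor
  · rw [QuotientGroup.nontrivial_iff]
    intro h
    exact hne (hL.eq_of_le hR (Subgroup.subgroupOf_eq_top.1 h))
  · intro H hH
    have hNM : L ⊓ R ≤ (H.comap (QuotientGroup.mk' (R.subgroupOf L))).map L.subtype := by
      rintro x ⟨hx, hxR⟩
      refine ⟨⟨x, hx⟩, ?_, rfl⟩
      have h1 : QuotientGroup.mk' (R.subgroupOf L) ⟨x, hx⟩ = 1 :=
        (QuotientGroup.eq_one_iff _).2 hxR
      change QuotientGroup.mk' (R.subgroupOf L) ⟨x, hx⟩ ∈ H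
      rw [h1]
      exact H.one_mem
    have hML : (H.comap (QuotientGroup.mk' (R.subgroupOf L))).map L.subtype ≤ L :=
      Subgroup.map_subtype_le _
    rcases hL.eq_inf_or_eq hG hR hne (map_comap_mk_normal H hH) hNM hML with h | h
    · left
      rw [eq_bot_iff]
      intro q hq
      obtain ⟨l, rfl⟩ := QuotientGroup.mk'_surjective _ q
      have hl : (l : G) ∈ L ⊓ R := h ▸ ⟨l, hq, rfl⟩
      exact (QuotientGroup.eq_one_iff l).2 hl.2
    · right
      rw [eq_top_iff]
      intro q _
      obtain ⟨l, rfl⟩ := QuotientGroup.mk'_surjective _ q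
      obtain ⟨m, hm, hml⟩ := h.ge l.2
      obtain rfl : m = l := Subtype.ext hml
      exact hm

theorem eq_orbit_or_eq_univ (hG : IsSemiprimitive G Ω) (hL : IsPlinth L Ω) (hR : IsPlinth R Ω)
    (P : Set (Set Ω)) (hP : Setoid.IsPartition P) (hinv : ∀ p ∈ P, ∀ g : G, g • p ∈ P)
    (horb : ∀ p ∈ P, ∀ ω ∈ p, (MulAction.orbit ↥(L ⊓ R) ω : Set Ω) ⊆ p) :
    (∀ p ∈ P, ∃ ω : Ω, p = MulAction.orbit ↥(L ⊓ R) ω) ∨ P = {Set.univ} := by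
  let s : Setoid Ω := Setoid.mkClasses P hP.2
  have hs_of : ∀ {p : Set Ω}, p ∈ P → ∀ {a b : Ω}, a ∈ p → b ∈ p → s a b := by
    intro p hp a b ha hb q hq haq
    rwa [Setoid.eq_of_mem_eqv_class hP.2 hq haq hp ha]
  have hs_mem : ∀ {p : Set Ω}, p ∈ P → ∀ {a b : Ω}, a ∈ p → s a b → b ∈ p :=
    fun hp _ _ ha hab => hab _ hp ha
  have hs : ∀ (g : G) (a b : Ω), s a b → s (g • a) (g • b) := by
    intro g a b hab
    obtain ⟨p, ⟨hp, ha⟩, -⟩ := hP.2 a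
    exact hs_of (hinv p hp g) (Set.smul_mem_smul_set ha)
      (Set.smul_mem_smul_set (hs_mem hp ha hab))
  have hN : ∀ n ∈ L ⊓ R, ∀ a, s a (n • a) := by
    intro n hn a
    obtain ⟨p, ⟨hp, ha⟩, -⟩ := hP.2 a
    exact hs_of hp ha (horb p hp a ha ⟨⟨n, hn⟩, rfl⟩)
  have hne : ∀ p ∈ P, p.Nonempty := fun p hp => Setoid.nonempty_of_mem_partition hP hp
  by_cases htop : ∀ a b, s a b
  · by_cases hΩ : Nonempty Ω
    · right
      obtain ⟨a⟩ := hΩ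
      have huniv : ∀ p ∈ P, p = Set.univ := by
        intro p hp
        obtain ⟨b, hb⟩ := hne p hp
        exact Set.eq_univ_of_forall fun c => hs_mem hp hb (htop b c)
      obtain ⟨p, ⟨hp, -⟩, -⟩ := hP.2 a
      exact Set.eq_singleton_iff_unique_mem.2 ⟨huniv p hp ▸ hp, huniv⟩
    · left
      intro p hp
      obtain ⟨a, -⟩ := hne p hp
      exact (hΩ ⟨a⟩).elim
  · left
    intro p hp
    obtain ⟨a, ha⟩ := hne p hp
    refine ⟨a, (horb p hp a ha).antisymm' fun b hb => ?_⟩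
    obtain ⟨n, hn, rfl⟩ := hL.exists_inf_smul_eq hG hR s hs hN htop (hs_of hp ha hb)
    exact ⟨⟨n, hn⟩, rfl⟩

end IsPlinth

/-- Let `G ≤ Sym(Ω)` be semiprimitive with at least two plinths.  Then there is a
characteristically simple group `X` such that for every pair of distinct plinths `L`, `R`
of `G`, the induced action of `G/(L ⊓ R)` on the set of `(L ⊓ R)`-orbits is primitive
(every `G`-invariant partition of `Ω` refined by the orbit partition is trivial) and
`L/(L ⊓ R) ≅ X ≅ R/(L ⊓ R)`. -/
theorem stmt7 {G : Type u} {Ω : Type*} [Group G] [MulAction G Ω] [FaithfulSMul G Ω]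
    (hG : IsSemiprimitive G Ω)
    (htwo : ∃ K L : Subgroup G, IsPlinth K Ω ∧ IsPlinth L Ω ∧ K ≠ L) :
    ∃ (X : Type u) (_ : Group X), IsCharSimple X ∧
      ∀ L R : Subgroup G, IsPlinth L Ω → IsPlinth R Ω → L ≠ R →
        -- G/(L ⊓ R) acts primitively on the set of (L ⊓ R)-orbits:
        ((∀ ω ω' : Ω, ∃ g : G, g • ω ∈ MulAction.orbit ↥(L ⊓ R) ω') ∧
          (∀ P : Set (Set Ω), Setoid.IsPartition P →
            (∀ p ∈ P, ∀ g : G, g • p ∈ P) →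
            (∀ p ∈ P, ∀ ω ∈ p, (MulAction.orbit ↥(L ⊓ R) ω : Set Ω) ⊆ p) →
            (∀ p ∈ P, ∃ ω : Ω, p = MulAction.orbit ↥(L ⊓ R) ω) ∨ P = {Set.univ})) ∧
        -- L/(L ⊓ R) ≅ X
        (∃ φ : ↥L →* X, Function.Surjective φ ∧ ∀ x : ↥L, φ x = 1 ↔ (x : G) ∈ L ⊓ R) ∧
        -- R/(L ⊓ R) ≅ X
        (∃ ψ : ↥R →* X, Function.Surjective ψ ∧ ∀ x : ↥R, ψ x = 1 ↔ (x : G) ∈ L ⊓ R) := by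
  obtain ⟨K, M, hK, hM, hKM⟩ := htwo
  have := hK.1
  have := hM.1
  have hfactor : ∀ L R : Subgroup G, IsPlinth L Ω → IsPlinth R Ω → L ≠ R →
      HasFactor L R (↥K ⧸ M.subgroupOf K) := by
    intro L R hL hR hLR
    have h := IsPlinth.hasFactor_quotient (L := K) (R := M)
    by_cases hKL : K = L
    · subst hKL
      exact hK.hasFactor_change hG hM hR hKM hLR h
    · exact hL.hasFactor_change hG hK hR (Ne.symm hKL) hLR
        (hK.hasFactor_symm hG hL hKL (hK.hasFactor_change hG hM hL hKM hKL h))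
  refine ⟨↥K ⧸ M.subgroupOf K, inferInstance, hK.isCharSimple_quotient hG hM hKM, ?_⟩
  intro L R hL hR hLR
  refine ⟨⟨fun ω ω' => ?_, hL.eq_orbit_or_eq_univ hG hR⟩, ?_, ?_⟩
  · obtain ⟨g, -, hg⟩ := hG.1 ω ω'
    exact ⟨g, hg ▸ MulAction.mem_orbit_self _⟩
  · exact (hfactor L R hL hR hLR).congr_right fun x hx => by simp [Subgroup.mem_inf, hx]
  · exact (hfactor R L hR hL hLR.symm).congr_right fun x hx => by simp [Subgroup.mem_inf, hx]
end

section
/- Let G ≤ Sym(Ω) be a semiprimitive permutation group with a soluble plinth K. Then: (i) K is regular and K is the unique plinth of G; (ii) every semiregular normal subgroup of G is contained in K; (iii) every transitive normal subgroup of G contains K. -/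
open Pointwise

open scoped commutatorElement

/-- If `A` centralises a transitive subgroup `K` modulo an intransitive normal subgroup `J`, then
point stabilisers in `A` fix every `J`-orbit; semiprimitivity forces them to be trivial. -/
theorem IsSemiprimitive.isSemiregularOn_of_commutator_le {G Ω : Type*} [Group G] [MulAction G Ω]
    (hG : IsSemiprimitive G Ω) {A K J : Subgroup G} (hA : A.Normal) (hJ : J.Normal)
    (hK : IsTransitiveOn K Ω) (hJt : ¬ IsTransitiveOn J Ω) (hc : ⁅A, K⁆ ≤ J) :
    IsSemiregularOn A Ω := by
  let X : Subgroup G :=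
    { carrier := {g | g ∈ A ∧ ∀ ω : Ω, ∃ j ∈ J, g • ω = j • ω}
      one_mem' := ⟨A.one_mem, fun ω => ⟨1, J.one_mem, rfl⟩⟩
      mul_mem' := by
        rintro g h ⟨hg, hg'⟩ ⟨hh, hh'⟩
        refine ⟨A.mul_mem hg hh, fun ω => ?_⟩
        obtain ⟨j, hj, e⟩ := hh' ω
        obtain ⟨i, hi, e'⟩ := hg' (j • ω)
        exact ⟨i * j, J.mul_mem hi hj, by rw [mul_smul, e, e', mul_smul]⟩
      inv_mem' := by
        rintro g ⟨hg, hg'⟩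
        refine ⟨A.inv_mem hg, fun ω => ?_⟩
        obtain ⟨j, hj, e⟩ := hg' (g⁻¹ • ω)
        exact ⟨j⁻¹, J.inv_mem hj, by rw [eq_inv_smul_iff, ← e, smul_inv_smul]⟩ }
  have hX : X.Normal := by
    refine ⟨?_⟩
    rintro n ⟨hn, hn'⟩ g
    refine ⟨hA.conj_mem n hn g, fun ω => ?_⟩
    obtain ⟨j, hj, e⟩ := hn' (g⁻¹ • ω)
    exact ⟨g * j * g⁻¹, hJ.conj_mem j hj g, by simp only [mul_smul, e]⟩
  rcases hG.2 X hX with hX' | hX'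
  · refine absurd (fun a b => ?_) hJt
    obtain ⟨x, ⟨-, hx⟩, rfl⟩ := hX' a b
    obtain ⟨j, hj, e⟩ := hx a
    exact ⟨j, hj, e.symm⟩
  · rintro a ha ⟨α, hα⟩
    refine hX' a ⟨ha, fun ω => ?_⟩ ⟨α, hα⟩
    obtain ⟨k, hk, rfl⟩ := hK α ω
    refine ⟨⁅a, k⁆, hc (Subgroup.commutator_mem_commutator ha hk), ?_⟩
    have hα' : a⁻¹ • α = α := by rw [inv_smul_eq_iff, hα]
    simp only [commutatorElement_def, mul_smul, inv_smul_smul, hα']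

/-- A soluble subgroup that is perfect modulo a normal subgroup `N` lies in `N`. -/
theorem Subgroup.le_of_le_commutator_sup {G : Type*} [Group G] {K N : Subgroup G} [N.Normal]
    [Group.IsSolvable K] (h : K ≤ ⁅K, K⁆ ⊔ N) : K ≤ N := by
  let P := K.map (QuotientGroup.mk' N)
  have hP : Group.IsSolvable P :=
    Group.isSolvable_of_surjective ((QuotientGroup.mk' N).subgroupMap_surjective K)
  have hle : P ≤ ⁅P, P⁆ := by
    have := Subgroup.map_mono (f := QuotientGroup.mk' N) h
    rwa [Subgroup.map_sup, Subgroup.map_commutator, QuotientGroup.map_mk'_self, sup_bot_eq] at this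
  have hbot : P = ⊥ := by
    by_contra hne
    have : Nontrivial P := P.nontrivial_iff_ne_bot.2 hne
    refine (Group.IsSolvable.commutator_lt_top_of_nontrivial P).not_ge ?_
    rwa [← Subgroup.map_subtype_le_map_subtype, map_commutator_eq, ← MonoidHom.range_eq_map,
      P.range_subtype]
  rwa [Subgroup.map_eq_bot_iff, QuotientGroup.ker_mk'] at hbot

theorem Subgroup.commutator_sup_le {G : Type*} [Group G] (N K : Subgroup G) [N.Normal]
    [K.Normal] : ⁅N ⊔ K, K⁆ ≤ ⁅K, K⁆ ⊔ (N ⊓ K) := by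
  rw [Subgroup.commutator_le]
  intro a ha k hk
  obtain ⟨n, hn, l, hl, rfl⟩ := Subgroup.mem_sup_of_normal_left.1 ha
  have e : ⁅n * l, k⁆ = (n * ⁅l, k⁆ * n⁻¹) * ⁅n, k⁆ := by
    simp only [commutatorElement_def]; group
  rw [e]
  refine Subgroup.mul_mem_sup ?_ (Subgroup.commutator_le_inf N K
    (Subgroup.commutator_mem_commutator hn hk))
  exact Subgroup.Normal.conj_mem inferInstance _ (Subgroup.commutator_mem_commutator hl hk) n

/-- A semiregular subgroup is contained in each of its transitive subgroups. -/
theorem IsSemiregularOn.le_of_isTransitiveOn {G Ω : Type*} [Group G] [MulAction G Ω]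
    [FaithfulSMul G Ω] {A K : Subgroup G} (hA : IsSemiregularOn A Ω) (hK : IsTransitiveOn K Ω)
    (hKA : K ≤ A) : A ≤ K := by
  intro a ha
  rcases isEmpty_or_nonempty Ω with hΩ | ⟨⟨α⟩⟩
  · rw [show a = 1 from FaithfulSMul.eq_of_smul_eq_smul (α := Ω) fun ω => hΩ.elim ω]
    exact K.one_mem
  · obtain ⟨k, hk, e⟩ := hK α (a • α)
    have := hA (k⁻¹ * a) (A.mul_mem (A.inv_mem (hKA hk)) ha)
      ⟨α, by rw [mul_smul, ← e, inv_smul_smul]⟩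
    rwa [← inv_mul_eq_one.1 this]

theorem IsPlinth.eq_of_le_s9 {G Ω : Type*} [Group G] [MulAction G Ω] {K N : Subgroup G}
    (hK : IsPlinth K Ω) (hN : N.Normal) (hNt : IsTransitiveOn N Ω) (h : N ≤ K) : N = K :=
  by_contra fun hne => hK.2.2 N hN (lt_of_le_of_ne h hne) hNt

theorem IsPlinth.le_or_isSemiregularOn_sup {G Ω : Type*} [Group G] [MulAction G Ω]
    (hG : IsSemiprimitive G Ω) {K N : Subgroup G} (hK : IsPlinth K Ω) [Group.IsSolvable K]
    (hN : N.Normal) : K ≤ N ∨ IsSemiregularOn (N ⊔ K) Ω := by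
  have := hK.1
  by_cases hJ : IsTransitiveOn (⁅K, K⁆ ⊔ (N ⊓ K)) Ω
  · left
    have e := hK.eq_of_le_s9 inferInstance hJ
      (sup_le (Subgroup.commutator_le_left K K) inf_le_right)
    exact Subgroup.le_of_le_commutator_sup (e.ge.trans (sup_le_sup_left inf_le_left _))
  · exact .inr (hG.isSemiregularOn_of_commutator_le inferInstance inferInstance hK.2.1 hJ
      (Subgroup.commutator_sup_le N K))

/-- Let `G ≤ Sym(Ω)` be semiprimitive with a soluble plinth `K`.  Then `K` is regular and is
the unique plinth of `G`, every semiregular normal subgroup of `G` is contained in `K`, and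
every transitive normal subgroup of `G` contains `K`. -/
theorem stmt9 {G Ω : Type*} [Group G] [MulAction G Ω] [FaithfulSMul G Ω]
    (hG : IsSemiprimitive G Ω) (K : Subgroup G) (hK : IsPlinth K Ω)
    (hsol : IsSolvable ↥K) :
    ((IsTransitiveOn K Ω ∧ IsSemiregularOn K Ω) ∧ ∀ L : Subgroup G, IsPlinth L Ω → L = K) ∧
    (∀ N : Subgroup G, N.Normal → IsSemiregularOn N Ω → N ≤ K) ∧
    (∀ T : Subgroup G, T.Normal → IsTransitiveOn T Ω → K ≤ T) := by
  have : Group.IsSolvable K := hsol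
  have hreg : IsSemiregularOn K Ω := by
    rcases hK.le_or_isSemiregularOn_sup hG (N := ⊥) inferInstance with h | h
    · exact fun n hn _ => Subgroup.mem_bot.1 (h hn)
    · rwa [bot_sup_eq] at h
  have hcomp : ∀ N : Subgroup G, N.Normal → K ≤ N ∨ N ≤ K := fun N hN =>
    (hK.le_or_isSemiregularOn_sup hG hN).imp_right fun h =>
      le_sup_left.trans (h.le_of_isTransitiveOn hK.2.1 le_sup_right)
  have htrans : ∀ T : Subgroup G, T.Normal → IsTransitiveOn T Ω → K ≤ T := fun T hT hTt =>
    (hcomp T hT).elim id fun h => (hK.eq_of_le_s9 hT hTt h).ge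
  exact ⟨⟨⟨hK.2.1, hreg⟩, fun L hL =>
      (hL.eq_of_le_s9 hK.1 hK.2.1 (htrans L hL.1 hL.2.1)).symm⟩,
    fun N hN hNs => (hcomp N hN).elim (hNs.le_of_isTransitiveOn hK.2.1) id, htrans⟩
end

section
/- Let G ≤ Sym(Ω), let K be a transitive normal subgroup of G, let ω ∈ Ω, and let σ = ω^{C_G(K)} be the orbit of ω under the centraliser C_G(K) of K in G. Let K_σ be the setwise stabiliser of σ in K. Then: for each k ∈ K_σ there is a unique r_k ∈ C_G(K) with k·r_k ∈ G_ω; (a) the map φ : K_σ → C_G(K) given by k ↦ r_k is a surjective group homomorphism with kernel K_ω; (b) K_σ = {k ∈ K : there exists h ∈ G_ω such that conjugation by k and conjugation by h induce the same automorphism of K}. -/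
open Pointwise

/-- The centraliser of a transitive subgroup is semiregular. -/
theorem IsTransitiveOn.isSemiregularOn_centralizer {G Ω : Type*} [Group G] [MulAction G Ω]
    [FaithfulSMul G Ω] {K : Subgroup G} (hK : IsTransitiveOn K Ω) :
    IsSemiregularOn (Subgroup.centralizer (K : Set G)) Ω := by
  rintro n hn ⟨a, ha⟩
  refine FaithfulSMul.eq_of_smul_eq_smul (α := Ω) fun b => ?_
  obtain ⟨k, hk, rfl⟩ := hK a b
  rw [one_smul, smul_smul, ← Subgroup.mem_centralizer_iff.mp hn k hk, ← smul_smul, ha]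

/-- An element of `K` stabilises the orbit of `ω` under the centraliser of `K` if and only if
some element of the centraliser corrects it to an element fixing `ω`. -/
theorem mem_stabilizer_orbit_centralizer_iff {G Ω : Type*} [Group G] [MulAction G Ω]
    {K : Subgroup G} {k : G} (hk : k ∈ K) (ω : Ω) :
    k ∈ MulAction.stabilizer G (MulAction.orbit (Subgroup.centralizer (K : Set G)) ω) ↔
      ∃ r ∈ Subgroup.centralizer (K : Set G), k * r ∈ MulAction.stabilizer G ω := by
  simp only [MulAction.mem_stabilizer_iff]
  constructor
  · intro h
    have hω : ω ∈ k • MulAction.orbit (Subgroup.centralizer (K : Set G)) ω := by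
      rw [h]
      exact MulAction.mem_orbit_self ω
    obtain ⟨-, ⟨r, rfl⟩, hr⟩ := hω
    exact ⟨r, r.2, by rw [mul_smul]; exact hr⟩
  · rintro ⟨r, hr, h⟩
    have hkω : k • ω = r⁻¹ • ω := by
      rw [eq_inv_smul_iff, smul_smul, ← Subgroup.mem_centralizer_iff.mp hr k hk, h]
    have hkω' : k⁻¹ • ω = r • ω := by
      rw [inv_smul_eq_iff, smul_smul, h]
    ext x
    rw [Set.mem_smul_set_iff_inv_smul_mem]
    constructor
    · rintro ⟨d, hd⟩
      refine ⟨d * ⟨r, hr⟩⁻¹, ?_⟩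
      have hd' : (d : G) • ω = k⁻¹ • x := hd
      change ((d : G) * r⁻¹) • ω = x
      rw [mul_smul, ← hkω, smul_smul, ← Subgroup.mem_centralizer_iff.mp d.2 k hk, mul_smul, hd',
        smul_inv_smul]
    · rintro ⟨d, rfl⟩
      refine ⟨d * ⟨r, hr⟩, ?_⟩
      change ((d : G) * r) • ω = k⁻¹ • (d : G) • ω
      rw [mul_smul, ← hkω', smul_smul, smul_smul,
        Subgroup.mem_centralizer_iff.mp d.2 k⁻¹ (K.inv_mem hk)]

/-- Let `G ≤ Sym(Ω)`, let `K` be a transitive normal subgroup of `G`, let `ω ∈ Ω`, let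
`C = C_G(K)`, let `σ = ω^C` and let `K_σ` be the setwise stabiliser of `σ` in `K`.  Then for
each `k ∈ K_σ` there is a unique `r_k ∈ C` with `k·r_k ∈ G_ω`; (a) `k ↦ r_k` is a surjective
homomorphism `K_σ → C` with kernel `K_ω`; (b) `K_σ` consists of those `k ∈ K` for which
conjugation by `k` agrees on `K` with conjugation by some `h ∈ G_ω`. -/
theorem stmt11 {G Ω : Type*} [Group G] [MulAction G Ω] [FaithfulSMul G Ω]
    (K : Subgroup G) (hKnormal : K.Normal) (hKtrans : IsTransitiveOn K Ω) (ω : Ω)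
    (C : Subgroup G) (hC : C = Subgroup.centralizer (K : Set G))
    (σ : Set Ω) (hσ : σ = MulAction.orbit C ω)
    (Kσ : Subgroup G) (hKσ : Kσ = K ⊓ MulAction.stabilizer G σ) :
    (∀ k ∈ Kσ, ∃! r : G, r ∈ C ∧ k * r ∈ MulAction.stabilizer G ω) ∧
    (∃ φ : ↥Kσ →* ↥C,
      (∀ k : ↥Kσ, (k : G) * ((φ k : G)) ∈ MulAction.stabilizer G ω) ∧
      Function.Surjective φ ∧
      (∀ k : ↥Kσ, φ k = 1 ↔ (k : G) ∈ MulAction.stabilizer G ω)) ∧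
    (∀ k : G, k ∈ Kσ ↔
      (k ∈ K ∧ ∃ h ∈ MulAction.stabilizer G ω, ∀ x ∈ K, k * x * k⁻¹ = h * x * h⁻¹)) := by
  subst hC hσ hKσ
  have comm : ∀ k ∈ K, ∀ r ∈ Subgroup.centralizer (K : Set G), k * r = r * k :=
    fun k hk r hr => Subgroup.mem_centralizer_iff.mp hr k hk
  have unique : ∀ k r s : G, r ∈ Subgroup.centralizer (K : Set G) →
      s ∈ Subgroup.centralizer (K : Set G) → k * r ∈ MulAction.stabilizer G ω →
      k * s ∈ MulAction.stabilizer G ω → r = s := by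
    intro k r s hr hs hkr hks
    have hmem := mul_mem (inv_mem hkr) hks
    rw [show (k * r)⁻¹ * (k * s) = r⁻¹ * s by group] at hmem
    exact inv_mul_eq_one.mp
      (hKtrans.isSemiregularOn_centralizer _ (mul_mem (inv_mem hr) hs) ⟨ω, hmem⟩)
  refine ⟨?_, ?_, ?_⟩
  · rintro k ⟨hk, hkσ⟩
    obtain ⟨r, hr, hkr⟩ := (mem_stabilizer_orbit_centralizer_iff hk ω).mp hkσ
    exact ⟨r, ⟨hr, hkr⟩, fun s hs => unique k s r hs.1 hr hs.2 hkr⟩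
  · choose f hf hfω using fun k : ↥(K ⊓ MulAction.stabilizer G
      (MulAction.orbit (Subgroup.centralizer (K : Set G)) ω)) =>
        (mem_stabilizer_orbit_centralizer_iff k.2.1 ω).mp k.2.2
    refine ⟨MonoidHom.mk' (fun k => ⟨f k, hf k⟩) fun a b => Subtype.ext ?_, hfω, ?_, ?_⟩
    · refine unique _ _ _ (hf _) (mul_mem (hf a) (hf b)) (hfω (a * b)) ?_
      change (a : G) * b * (f a * f b) ∈ _
      rw [mul_assoc, ← mul_assoc (b : G), comm b b.2.1 _ (hf a), mul_assoc (f a), ← mul_assoc]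
      exact mul_mem (hfω a) (hfω b)
    · rintro ⟨c, hc⟩
      obtain ⟨k, hk, hkc⟩ := hKtrans (c • ω) ω
      have hkc' : k * c ∈ MulAction.stabilizer G ω := by
        rw [MulAction.mem_stabilizer_iff, mul_smul, hkc]
      have hkσ := (mem_stabilizer_orbit_centralizer_iff hk ω).mpr ⟨c, hc, hkc'⟩
      exact ⟨⟨k, hk, hkσ⟩, Subtype.ext (unique k _ _ (hf _) hc (hfω ⟨k, hk, hkσ⟩) hkc')⟩
    · intro k
      constructor
      · intro h
        have hk : f k = 1 := congrArg Subtype.val h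
        simpa only [hk, mul_one] using hfω k
      · intro h
        exact Subtype.ext (unique k _ _ (hf k) (one_mem _) (hfω k)
          (by rwa [OneMemClass.coe_one, mul_one]))
  · intro k
    rw [Subgroup.mem_inf, and_congr_right_iff]
    intro hk
    rw [mem_stabilizer_orbit_centralizer_iff hk]
    constructor
    · rintro ⟨r, hr, hkr⟩
      refine ⟨k * r, hkr, fun x hx => ?_⟩
      rw [mul_assoc k r x, ← comm x hx r hr]
      group
    · rintro ⟨h, hh, hconj⟩
      refine ⟨k⁻¹ * h, Subgroup.mem_centralizer_iff.mpr fun x hx => ?_, by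
        rwa [mul_inv_cancel_left]⟩
      calc x * (k⁻¹ * h) = k⁻¹ * (k * x * k⁻¹) * h := by group
        _ = k⁻¹ * (h * x * h⁻¹) * h := by rw [hconj x hx]
        _ = k⁻¹ * h * x := by group
end

section
/- Let G be a finite group with normal subgroups N and K satisfying N ≤ K. Let 𝒮 = {M₁,…,M_r} be a set of normal subgroups of G, each maximal with respect to N ≤ M_i < K (i.e. each M_i is a normal subgroup of G with N ≤ M_i < K such that there is no normal subgroup M′ of G with M_i < M′ < K), and set S = ⋂_{M∈𝒮} M. Then: (i) K/S is the internal direct product L₁ × ⋯ × L_s of minimal normal subgroups L₁,…,L_s of G/S, with s ≤ r; (ii) each L_i is isomorphic to K/M for some M ∈ 𝒮; (iii) if K/S is perfect, then s = r. -/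
/-- `N` is a minimal normal subgroup. -/
def IsMinimalNormal {G : Type*} [Group G] (N : Subgroup G) : Prop :=
  N.Normal ∧ N ≠ ⊥ ∧ ∀ N' : Subgroup G, N'.Normal → N' ≤ N → N' = ⊥ ∨ N' = N

theorem Subgroup.inf_sup_le_of_le_of_normal {G : Type*} [Group G] {A R M : Subgroup G}
    (hM : M.Normal) (hRA : R ≤ A) : A ⊓ (R ⊔ M) ≤ R ⊔ (A ⊓ M) := by
  rintro x ⟨hxA, hx⟩
  obtain ⟨r, hr, m, hm, rfl⟩ := Subgroup.mem_sup_of_normal_right.1 hx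
  exact mul_mem (Subgroup.mem_sup_left hr)
    (Subgroup.mem_sup_right ⟨(Subgroup.mul_mem_cancel_left A (hRA hr)).1 hxA, hm⟩)

theorem Subgroup.commutator_sup_le_s12 {G : Type*} [Group G] {A B C S : Subgroup G}
    (hS : S.Normal) (hB : ⁅A, B⁆ ≤ S) (hC : ⁅A, C⁆ ≤ S) : ⁅A, B ⊔ C⁆ ≤ S := by
  have key : ∀ D : Subgroup G, ⁅A, D⁆ ≤ S ↔
      D ≤ (Subgroup.centralizer (A.map (QuotientGroup.mk' S) : Set (G ⧸ S))).comap
        (QuotientGroup.mk' S) := by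
    intro D
    rw [← Subgroup.map_le_iff_le_comap, ← Subgroup.commutator_eq_bot_iff_le_centralizer,
      ← Subgroup.map_commutator, Subgroup.map_eq_bot_iff, QuotientGroup.ker_mk',
      Subgroup.commutator_comm]
  rw [key] at *
  exact sup_le hB hC

/-- The second isomorphism theorem, as a surjection `K → R / S` with kernel `M`, where `K = R M`
and `S = R ∩ M`. -/
theorem Subgroup.exists_surjective_map_mk_of_sup_eq {G : Type*} [Group G] {R M K S : Subgroup G}
    [S.Normal] (hM : M.Normal) (hsup : R ⊔ M = K) (hinf : R ⊓ M = S) :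
    ∃ φ : ↥K →* ↥(R.map (QuotientGroup.mk' S)), Function.Surjective φ ∧
      ∀ k : ↥K, φ k = 1 ↔ (k : G) ∈ M := by
  have hRK : R ≤ K := hsup ▸ le_sup_left
  let q := QuotientGroup.mk' (M.subgroupOf K)
  let f : R →* K ⧸ M.subgroupOf K := q.comp (Subgroup.inclusion hRK)
  let g : R →* R.map (QuotientGroup.mk' S) := (QuotientGroup.mk' S).subgroupMap R
  have hg : Function.Surjective g := (QuotientGroup.mk' S).subgroupMap_surjective R
  have hfker : ∀ r : R, f r = 1 ↔ (r : G) ∈ M := fun r =>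
    (QuotientGroup.eq_one_iff _).trans Subgroup.mem_subgroupOf
  have hgker : ∀ r : R, g r = 1 ↔ (r : G) ∈ M := fun r => by
    rw [Subtype.ext_iff]
    refine (QuotientGroup.eq_one_iff (r : G)).trans ?_
    rw [← hinf]
    exact ⟨fun h => h.2, fun h => ⟨r.2, h⟩⟩
  have hf : Function.Surjective f := by
    intro y
    obtain ⟨⟨k, hk⟩, rfl⟩ := QuotientGroup.mk_surjective y
    rw [← hsup] at hk
    obtain ⟨r, hr, m, hm, rfl⟩ := Subgroup.mem_sup_of_normal_right.1 hk
    refine ⟨⟨r, hr⟩, QuotientGroup.eq.2 (Subgroup.mem_subgroupOf.2 ?_)⟩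
    simpa using hm
  have hker : f.ker = g.ker := by
    ext r
    rw [MonoidHom.mem_ker, MonoidHom.mem_ker, hfker, hgker]
  let e : K ⧸ M.subgroupOf K ≃* R.map (QuotientGroup.mk' S) :=
    (QuotientGroup.quotientKerEquivOfSurjective f hf).symm.trans
      ((QuotientGroup.quotientMulEquivOfEq hker).trans
        (QuotientGroup.quotientKerEquivOfSurjective g hg))
  refine ⟨e.toMonoidHom.comp q, e.surjective.comp (QuotientGroup.mk'_surjective _), fun k => ?_⟩
  exact (e.map_eq_one_iff).trans ((QuotientGroup.eq_one_iff k).trans Subgroup.mem_subgroupOf)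

/-- If `R / S` is isomorphic as a `G`-group to a chief factor `K / M`, then no normal subgroup of
`G` lies strictly between `S` and `R`. -/
theorem Subgroup.le_or_eq_of_le_of_sup_eq {G : Type*} [Group G] {R M K S Y : Subgroup G}
    (hM : M.Normal) (hmax : ∀ M' : Subgroup G, M'.Normal → M < M' → ¬ M' < K)
    (hsup : R ⊔ M = K) (hinf : R ⊓ M = S) (hY : Y.Normal) (hSY : S ≤ Y) (hYR : Y ≤ R) :
    Y ≤ S ∨ Y = R := by
  by_cases hYM : Y ≤ M
  · exact Or.inl (hinf ▸ le_inf hYR hYM)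
  · right
    have hK : Y ⊔ M = K := by
      by_contra hne
      exact hmax (Y ⊔ M) inferInstance (right_lt_sup.2 hYM)
        (lt_of_le_of_ne (hsup ▸ sup_le_sup_right hYR M) hne)
    have h := Subgroup.inf_sup_le_of_le_of_normal hM hYR
    rw [hK, hinf, sup_eq_left.2 hSY, inf_eq_left.2 (hsup ▸ le_sup_left)] at h
    exact le_antisymm hYR h

/-- A normal subgroup `R / S` of `G / S` isomorphic as a `G`-group to a chief factor `K / M` is a
minimal normal subgroup. -/
theorem isMinimalNormal_map_mk_of_sup_eq {G : Type*} [Group G] {R M K S : Subgroup G}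
    [S.Normal] (hR : R.Normal) (hM : M.Normal) (hMK : M < K)
    (hmax : ∀ M' : Subgroup G, M'.Normal → M < M' → ¬ M' < K)
    (hsup : R ⊔ M = K) (hinf : R ⊓ M = S) :
    IsMinimalNormal (R.map (QuotientGroup.mk' S)) := by
  refine ⟨hR.map _ (QuotientGroup.mk'_surjective S), fun h => ?_, fun X hX hXR => ?_⟩
  · rw [Subgroup.map_eq_bot_iff, QuotientGroup.ker_mk', ← hinf] at h
    exact hMK.ne (hsup ▸ (sup_eq_right.2 (h.trans inf_le_right)).symm)
  · have hXmap := Subgroup.map_comap_eq_self_of_surjective (QuotientGroup.mk'_surjective S) X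
    have hSR : (QuotientGroup.mk' S).ker ≤ R := by
      rw [QuotientGroup.ker_mk', ← hinf]
      exact inf_le_left
    have hSX : S ≤ X.comap (QuotientGroup.mk' S) := by
      simpa using Subgroup.ker_le_comap (QuotientGroup.mk' S) X
    have hle : X.comap (QuotientGroup.mk' S) ≤ R := by
      simpa [Subgroup.comap_map_eq_self hSR] using
        Subgroup.comap_mono (f := QuotientGroup.mk' S) hXR
    rcases Subgroup.le_or_eq_of_le_of_sup_eq hM hmax hsup hinf (hX.comap _) hSX hle with h | h
    · left
      rw [← hXmap, Subgroup.map_eq_bot_iff, QuotientGroup.ker_mk']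
      exact h
    · right
      rw [← hXmap, h]

/-- If each `R M` supplements `M` in `K` and lies in every other member of `T`, then the `R M`
generate `K` modulo the intersection. -/
theorem Subgroup.le_iSup_sup_iInf {G : Type*} [Group G] (K : Subgroup G)
    (T U : Finset (Subgroup G)) (R : Subgroup G → Subgroup G) (hUT : U ⊆ T)
    (hn : ∀ M ∈ T, M.Normal) (hR : ∀ M ∈ T, R M ⊔ M = K)
    (hle : ∀ M ∈ T, ∀ M' ∈ T, M' ≠ M → R M ≤ M') :
    K ≤ (⨆ M ∈ U, R M) ⊔ (K ⊓ ⨅ M ∈ U, M) := by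
  classical
  induction U using Finset.induction_on with
  | empty => simp
  | insert M U hMU ih =>
    have hMT := hUT (Finset.mem_insert_self M U)
    have hUT' := (Finset.subset_insert M U).trans hUT
    refine (ih hUT').trans ?_
    rw [Finset.iSup_insert, Finset.iInf_insert]
    have h1 : R M ≤ K ⊓ ⨅ M' ∈ U, M' := by
      refine le_inf ((hR M hMT).le.trans' le_sup_left) (le_iInf₂ fun M' h' => ?_)
      exact hle M hMT M' (hUT' h') (fun h => hMU (h ▸ h'))
    have h2 := Subgroup.inf_sup_le_of_le_of_normal (hn M hMT) h1
    rw [hR M hMT, inf_eq_left.2 inf_le_left] at h2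
    refine sup_le (le_sup_right.trans le_sup_left) (h2.trans (sup_le ?_ ?_))
    · exact le_sup_left.trans le_sup_left
    · refine le_trans (le_of_eq ?_) le_sup_right
      rw [inf_assoc, inf_comm M]

/-- Let `R / S` be isomorphic as a `G`-group to a chief factor `K / M`. If `K = [K, K] S` and `M₀`
is a maximal `G`-normal subgroup of `K` containing `S` but not `R`, then `M₀ = M`. -/
theorem Subgroup.eq_of_not_le_of_le_commutator_sup {G : Type*} [Group G]
    {R M M₀ K S : Subgroup G} (hR : R.Normal) (hM : M.Normal) (hM₀ : M₀.Normal) (hS : S.Normal)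
    (hMK : M < K) (hmax : ∀ M' : Subgroup G, M'.Normal → M < M' → ¬ M' < K)
    (hM₀K : M₀ < K) (hmax₀ : ∀ M' : Subgroup G, M'.Normal → M₀ < M' → ¬ M' < K)
    (hsup : R ⊔ M = K) (hinf : R ⊓ M = S) (hSM₀ : S ≤ M₀) (hRM₀ : ¬ R ≤ M₀)
    (hperf : K ≤ ⁅K, K⁆ ⊔ S) : M₀ = M := by
  by_contra hne
  have hSR : S ≤ R := hinf ▸ inf_le_left
  have hSM : S ≤ M := hinf ▸ inf_le_right
  have hRM₀S : R ⊓ M₀ ≤ S :=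
    (Subgroup.le_or_eq_of_le_of_sup_eq hM hmax hsup hinf inferInstance (le_inf hSR hSM₀)
      inf_le_left).resolve_right fun h => hRM₀ (inf_eq_left.1 h)
  have hMM₀ : M ⊔ M₀ = K := by
    by_contra hK
    have hlt : M ⊔ M₀ < K := lt_of_le_of_ne (sup_le hMK.le hM₀K.le) hK
    have h₁ : M₀ ≤ M := by
      by_contra h
      exact hmax _ inferInstance (left_lt_sup.2 h) hlt
    have h₂ : M ≤ M₀ := by
      by_contra h
      exact hmax₀ _ inferInstance (right_lt_sup.2 h) hlt
    exact hne (le_antisymm h₁ h₂)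
  have hRK : ⁅R, K⁆ ≤ S := by
    rw [← hMM₀]
    exact Subgroup.commutator_sup_le_s12 hS ((Subgroup.commutator_le_inf R M).trans hinf.le)
      ((Subgroup.commutator_le_inf R M₀).trans hRM₀S)
  have hKK : ⁅K, R ⊔ M⁆ ≤ M := Subgroup.commutator_sup_le_s12 hM
    ((Subgroup.commutator_comm K R).le.trans (hRK.trans hSM)) (Subgroup.commutator_le_right K M)
  rw [hsup] at hKK
  exact hMK.not_ge (hperf.trans (sup_le hKK hSM))

/-- Let `G` be a finite group with normal subgroups `N ≤ K`, let `𝒮` be a set of normal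
subgroups of `G` maximal with respect to `N ≤ M < K`, and let `S = ⋂_{M ∈ 𝒮} M`.  Then
`K/S` is an internal direct product `L₁ × ⋯ × L_s` of minimal normal subgroups of `G/S`
with `s ≤ |𝒮|`, each `Lᵢ` is isomorphic to `K/M` for some `M ∈ 𝒮`, and if `K/S` is
perfect then `s = |𝒮|`. -/
theorem stmt12 {G : Type*} [Group G] [Finite G]
    (N K : Subgroup G) (hN : N.Normal) (hK : K.Normal) (hNK : N ≤ K)
    (𝒮 : Finset (Subgroup G))
    (h𝒮 : ∀ M ∈ 𝒮, M.Normal ∧ N ≤ M ∧ M < K ∧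
      ∀ M' : Subgroup G, M'.Normal → M < M' → ¬ M' < K)
    (S : Subgroup G) [hSn : S.Normal] (hS : S = ⨅ M ∈ 𝒮, M) :
    ∃ (s : ℕ) (L : Fin s → Subgroup (G ⧸ S)),
      s ≤ 𝒮.card ∧
      -- each Lᵢ is a minimal normal subgroup of G/S
      (∀ i, IsMinimalNormal (L i)) ∧
      -- the Lᵢ pairwise commute
      (∀ i j, i ≠ j → ∀ x ∈ L i, ∀ y ∈ L j, Commute x y) ∧
      -- each Lᵢ meets the product of the others trivially
      (∀ i : Fin s, Disjoint (L i) (⨆ j, ⨆ _ : j ≠ i, L j)) ∧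
      -- together they generate K/S
      (⨆ i, L i) = K.map (QuotientGroup.mk' S) ∧
      -- each Lᵢ is isomorphic to K/M for some M ∈ 𝒮
      (∀ i, ∃ M ∈ 𝒮, ∃ φ : ↥K →* ↥(L i), Function.Surjective φ ∧
        ∀ k : ↥K, φ k = 1 ↔ (k : G) ∈ M) ∧
      -- if K/S is perfect then s = |𝒮|
      (⁅K.map (QuotientGroup.mk' S), K.map (QuotientGroup.mk' S)⁆ = K.map (QuotientGroup.mk' S)
        → s = 𝒮.card) := by
  classical
  obtain ⟨T, hT𝒮, hT⟩ := exists_minimal_le_of_wellFoundedLT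
    (fun T : Finset (Subgroup G) => K ⊓ ⨅ M ∈ T, M ≤ S) 𝒮 (hS ▸ inf_le_right)
  have hnormal : ∀ M ∈ T, M.Normal := fun M hM => (h𝒮 M (hT𝒮 hM)).1
  have hSle : ∀ M ∈ 𝒮, S ≤ M := fun M hM => hS ▸ iInf₂_le M hM
  let R : Subgroup G → Subgroup G := fun M => K ⊓ ⨅ M' ∈ T.erase M, M'
  have hRnormal : ∀ M, (R M).Normal := fun M =>
    have : (⨅ M' ∈ T.erase M, M').Normal :=
      Subgroup.normal_iInf_normal fun M' => Subgroup.normal_iInf_normal fun h =>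
        hnormal M' (Finset.mem_of_mem_erase h)
    inferInstanceAs (K ⊓ ⨅ M' ∈ T.erase M, M').Normal
  have hRle : ∀ M ∈ T, ∀ M' ∈ T, M' ≠ M → R M ≤ M' := fun M _ M' hM' hne =>
    inf_le_right.trans (iInf₂_le M' (Finset.mem_erase.2 ⟨hne, hM'⟩))
  have hinf : ∀ M ∈ T, R M ⊓ M = S := by
    intro M hM
    refine le_antisymm (le_trans (le_inf (inf_le_left.trans inf_le_left) (le_iInf₂ ?_)) hT.prop)
      (le_inf (le_inf ((hSle M (hT𝒮 hM)).trans (h𝒮 M (hT𝒮 hM)).2.2.1.le)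
        (le_iInf₂ fun M' h => hSle M' (hT𝒮 (Finset.mem_of_mem_erase h)))) (hSle M (hT𝒮 hM)))
    intro M' hM'
    by_cases h : M' = M
    · exact h ▸ inf_le_right
    · exact inf_le_left.trans (hRle M hM M' hM' h)
  have hRM : ∀ M ∈ T, ¬ R M ≤ M := fun M hM h =>
    Finset.notMem_erase M T (hT.le_of_le (y := T.erase M)
      (show R M ≤ S from hinf M hM ▸ le_inf le_rfl h) (Finset.erase_subset M T) hM)
  have hsup : ∀ M ∈ T, R M ⊔ M = K := by
    intro M hM
    have hMn := hnormal M hM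
    have hRn := hRnormal M
    by_contra hne
    exact (h𝒮 M (hT𝒮 hM)).2.2.2 _ inferInstance (right_lt_sup.2 (hRM M hM))
      (lt_of_le_of_ne (sup_le inf_le_left (h𝒮 M (hT𝒮 hM)).2.2.1.le) hne)
  have hgen : K ≤ (⨆ M ∈ T, R M) ⊔ S :=
    (Subgroup.le_iSup_sup_iInf K T T R subset_rfl hnormal hsup hRle).trans
      (sup_le_sup_left hT.prop _)
  let L : T → Subgroup (G ⧸ S) := fun M => (R M).map (QuotientGroup.mk' S)
  have hdisj : ∀ M : T, ∀ X : Subgroup (G ⧸ S),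
      X ≤ (M : Subgroup G).map (QuotientGroup.mk' S) → Disjoint (L M) X := by
    rintro ⟨M, hM⟩ X hX
    refine Disjoint.mono_right hX (Subgroup.disjoint_def.2 ?_)
    rintro _ ⟨r, hr, rfl⟩ ⟨m, hm, hmr⟩
    have hrM : r ∈ M := by
      have := (hSle M (hT𝒮 hM)) (QuotientGroup.eq.1 hmr)
      exact (Subgroup.mul_mem_cancel_left M (inv_mem hm)).1 this
    exact (QuotientGroup.eq_one_iff r).2 (hinf M hM ▸ ⟨hr, hrM⟩)
  have hLle : ∀ M M' : T, M' ≠ M → L M' ≤ (M : Subgroup G).map (QuotientGroup.mk' S) :=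
    fun M M' hne => Subgroup.map_mono
      (hRle M' M'.2 M M.2 fun h => hne (Subtype.ext h.symm))
  have hmin : ∀ M : T, IsMinimalNormal (L M) := fun M =>
    isMinimalNormal_map_mk_of_sup_eq (hRnormal M) (hnormal M M.2) (h𝒮 M (hT𝒮 M.2)).2.2.1
      (h𝒮 M (hT𝒮 M.2)).2.2.2 (hsup M M.2) (hinf M M.2)
  let e := T.equivFin.symm
  refine ⟨T.card, fun i => L (e i), Finset.card_le_card hT𝒮, fun i => hmin _, ?_, ?_, ?_, ?_, ?_⟩
  · intro i j hij x hx y hy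
    exact Subgroup.commute_of_normal_of_disjoint _ _ (hmin (e i)).1 (hmin (e j)).1
      (hdisj _ _ (hLle _ _ (e.injective.ne hij.symm))) x y hx hy
  · exact fun i => hdisj _ _ (iSup₂_le fun j hj => hLle _ _ (e.injective.ne hj))
  · rw [e.iSup_comp (g := L)]
    refine le_antisymm (iSup_le fun M => Subgroup.map_mono inf_le_left) ?_
    refine (Subgroup.map_mono hgen).trans ?_
    rw [Subgroup.map_sup, (Subgroup.map_eq_bot_iff S).2 (QuotientGroup.ker_mk' S).ge, sup_bot_eq,
      Subgroup.map_le_iff_le_comap]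
    exact iSup₂_le fun M hM => Subgroup.map_le_iff_le_comap.1 (le_iSup L ⟨M, hM⟩)
  · exact fun i => ⟨e i, hT𝒮 (e i).2,
      Subgroup.exists_surjective_map_mk_of_sup_eq (hnormal _ (e i).2) (hsup _ (e i).2)
        (hinf _ (e i).2)⟩
  · intro hperf
    have hKK : K ≤ ⁅K, K⁆ ⊔ S := by
      rw [← Subgroup.map_commutator] at hperf
      simpa using Subgroup.map_le_map_iff.1 hperf.ge
    refine congrArg Finset.card (hT𝒮.antisymm fun M₀ hM₀ => ?_)
    obtain ⟨hM₀n, -, hM₀K, hmax₀⟩ := h𝒮 M₀ hM₀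
    obtain ⟨M, hM, hRM₀⟩ : ∃ M ∈ T, ¬ R M ≤ M₀ := by
      by_contra! h
      exact hM₀K.not_ge (hgen.trans (sup_le (iSup₂_le h) (hSle M₀ hM₀)))
    obtain ⟨hMn, -, hMK, hmax⟩ := h𝒮 M (hT𝒮 hM)
    rwa [Subgroup.eq_of_not_le_of_le_commutator_sup (hRnormal M) hMn hM₀n hSn hMK hmax hM₀K hmax₀
      (hsup M hM) (hinf M hM) (hSle M₀ hM₀) hRM₀ hKK]
end

section
/- Let G ≤ Sym(Ω) be a finite semiprimitive permutation group with at least two plinths, and let ω ∈ Ω. Then for every prime p, the p-core O_p(G_ω) of the point-stabiliser G_ω is trivial. -/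
open Pointwise

open scoped commutatorElement

/-- In a semiprimitive group, let `P` be an intransitive normal subgroup and `K` a transitive
subgroup. A normal subgroup `Y` of a point-stabiliser with `⁅K, Y⁆ ≤ P` is trivial. -/
theorem IsSemiprimitive.eq_bot_of_commutator_le {G Ω : Type*} [Group G] [MulAction G Ω]
    (hG : IsSemiprimitive G Ω) {K P Y : Subgroup G} {ω : Ω} (hK : IsTransitiveOn K Ω)
    (hPn : P.Normal) (hP : ¬ IsTransitiveOn P Ω) (hY : Y ≤ MulAction.stabilizer G ω)
    (hYn : ∀ h ∈ MulAction.stabilizer G ω, ∀ y ∈ Y, h * y * h⁻¹ ∈ Y)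
    (hKY : ⁅K, Y⁆ ≤ P) : Y = ⊥ := by
  have conj_mem : ∀ g : G, ∀ y ∈ Y, g * y * g⁻¹ ∈ P ⊔ Y := by
    intro g y hy
    obtain ⟨k, hk, hkg⟩ := hK ω (g • ω)
    have hh : k⁻¹ * g ∈ MulAction.stabilizer G ω := by
      rw [MulAction.mem_stabilizer_iff, mul_smul, ← hkg, inv_smul_smul]
    have hy' := hYn _ hh y hy
    have hc : ⁅k, k⁻¹ * g * y * (k⁻¹ * g)⁻¹⁆ ∈ P :=
      hKY (Subgroup.commutator_mem_commutator hk hy')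
    have := mul_mem (Subgroup.mem_sup_left (T := Y) hc) (Subgroup.mem_sup_right (S := P) hy')
    convert this using 1
    rw [commutatorElement_def]
    group
  have hN : (P ⊔ Y).Normal := by
    refine ⟨fun n hn g => ?_⟩
    obtain ⟨a, ha, y, hy, rfl⟩ := Subgroup.mem_sup_of_normal_left.1 hn
    have := mul_mem (Subgroup.mem_sup_left (T := Y) (hPn.conj_mem a ha g)) (conj_mem g y hy)
    convert this using 1
    group
  rcases hG.2 _ hN with ht | hs
  · refine absurd (fun a b => ?_) hP
    have orbit : ∀ c : Ω, ∃ n ∈ P, n • ω = c := by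
      intro c
      obtain ⟨n, hn, rfl⟩ := ht ω c
      obtain ⟨x, hx, y, hy, rfl⟩ := Subgroup.mem_sup_of_normal_left.1 hn
      exact ⟨x, hx, by rw [mul_smul, MulAction.mem_stabilizer_iff.1 (hY hy)]⟩
    obtain ⟨m, hm, rfl⟩ := orbit a
    obtain ⟨n, hn, rfl⟩ := orbit b
    exact ⟨n * m⁻¹, mul_mem hn (inv_mem hm), by rw [mul_smul, inv_smul_smul]⟩
  · exact (Subgroup.eq_bot_iff_forall _).2 fun y hy =>
      hs y (Subgroup.mem_sup_right hy) ⟨ω, hY hy⟩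

theorem IsPlinth.not_le {G Ω : Type*} [Group G] [MulAction G Ω] {K L : Subgroup G}
    (hK : IsPlinth K Ω) (hL : IsPlinth L Ω) (hne : K ≠ L) : ¬ K ≤ L :=
  fun hle => hL.2.2 K hK.1 (lt_of_le_of_ne hle hne) hK.2.1

/-- If `L` is a normal transitive subgroup and `Y` is a normal subgroup of a point-stabiliser,
then `L ⊔ Y` is normal. -/
theorem IsTransitiveOn.normal_sup {G Ω : Type*} [Group G] [MulAction G Ω]
    {L Y : Subgroup G} {ω : Ω} (hLn : L.Normal) (hL : IsTransitiveOn L Ω)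
    (hYn : ∀ h ∈ MulAction.stabilizer G ω, ∀ y ∈ Y, h * y * h⁻¹ ∈ Y) : (L ⊔ Y).Normal := by
  refine ⟨fun n hn g => ?_⟩
  obtain ⟨l, hl, y, hy, rfl⟩ := Subgroup.mem_sup_of_normal_left.1 hn
  obtain ⟨k, hk, hkg⟩ := hL ω (g • ω)
  have hh : k⁻¹ * g ∈ MulAction.stabilizer G ω := by
    rw [MulAction.mem_stabilizer_iff, mul_smul, ← hkg, inv_smul_smul]
  have hk' : k ∈ L ⊔ Y := Subgroup.mem_sup_left hk
  have := mul_mem (Subgroup.mem_sup_left (T := Y) (hLn.conj_mem l hl g))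
    (mul_mem (mul_mem hk' (Subgroup.mem_sup_right (hYn _ hh y hy))) (inv_mem hk'))
  convert this using 1
  group

/-- If `K` is contained in `L ⊔ Q` with `L` normal and `Q` a finite `p`-group, and `K` is the
product of its derived subgroup and `K ⊓ L`, then `K ≤ L`. -/
theorem Subgroup.le_of_le_sup_isPGroup {G : Type*} [Group G] [Finite G] {p : ℕ} (hp : p.Prime)
    {K L Q : Subgroup G} [L.Normal] (hQ : IsPGroup p Q) (hKQ : K ≤ L ⊔ Q)
    (hK : K ≤ ⁅K, K⁆ ⊔ K ⊓ L) : K ≤ L := by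
  have : Fact p.Prime := ⟨hp⟩
  let π := QuotientGroup.mk' L
  have hL : L.map π = ⊥ := by
    rw [Subgroup.map_eq_bot_iff, QuotientGroup.ker_mk']
  have hπK : IsPGroup p (K.map π) := by
    refine (hQ.map π).to_le ?_
    have := Subgroup.map_mono (f := π) hKQ
    rwa [Subgroup.map_sup, hL, bot_sup_eq] at this
  have hle : K.map π ≤ ⁅K.map π, K.map π⁆ := by
    have h := Subgroup.map_mono (f := π) hK
    have h0 : (K ⊓ L).map π = ⊥ := le_bot_iff.1 (hL ▸ Subgroup.map_mono inf_le_right)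
    rwa [Subgroup.map_sup, h0, sup_bot_eq, Subgroup.map_commutator] at h
  rw [← QuotientGroup.ker_mk' L, ← Subgroup.map_eq_bot_iff]
  by_contra hne
  have : Nontrivial (K.map π) := (Subgroup.nontrivial_iff_ne_bot _).2 hne
  have : Group.IsNilpotent (K.map π) := hπK.isNilpotent
  refine (Group.IsSolvable.commutator_lt_top_of_nontrivial (K.map π)).not_ge fun x _ => ?_
  have hx := hle x.2
  rw [← Subgroup.map_subtype_commutator] at hx
  obtain ⟨y, hy, hyx⟩ := hx
  rwa [← Subtype.ext hyx]

/-- Let `G ≤ Sym(Ω)` be a finite semiprimitive group with at least two plinths and let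
`ω ∈ Ω`.  Then for every prime `p`, the `p`-core `O_p(G_ω)` is trivial, i.e. every normal
`p`-subgroup of `G_ω` is trivial. -/
theorem stmt13 {G Ω : Type*} [Group G] [Finite G] [MulAction G Ω] [FaithfulSMul G Ω]
    (hG : IsSemiprimitive G Ω)
    (htwo : ∃ K L : Subgroup G, IsPlinth K Ω ∧ IsPlinth L Ω ∧ K ≠ L)
    (ω : Ω) (p : ℕ) (hp : p.Prime)
    (Q : Subgroup ↥(MulAction.stabilizer G ω)) (hQ : Q.Normal) (hQp : IsPGroup p ↥Q) :
    Q = ⊥ := by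
  obtain ⟨K, L, hK, hL, hne⟩ := htwo
  have hKn : K.Normal := hK.1
  have hLn : L.Normal := hL.1
  let R : Subgroup G := Q.map (MulAction.stabilizer G ω).subtype
  have hRn : ∀ h ∈ MulAction.stabilizer G ω, ∀ y ∈ R, h * y * h⁻¹ ∈ R := by
    rintro h hh _ ⟨y, hy, rfl⟩
    exact ⟨⟨h, hh⟩ * y * ⟨h, hh⟩⁻¹, hQ.conj_mem y hy _, rfl⟩
  suffices hR : R = ⊥ from
    (Subgroup.map_eq_bot_iff_of_injective Q (Subgroup.subtype_injective _)).1 hR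
  have hLR : (L ⊔ R).Normal := hL.2.1.normal_sup hLn hRn
  by_cases hKR : K ≤ L ⊔ R
  · exfalso
    have hlt : ⁅K, K⁆ ⊔ K ⊓ L < K :=
      lt_of_le_not_ge (sup_le (Subgroup.commutator_le_left K K) inf_le_left) fun h =>
        hK.not_le hL hne (Subgroup.le_of_le_sup_isPGroup hp (hQp.map _) hKR h)
    have hcomm : ⁅K, (K ⊔ L) ⊓ MulAction.stabilizer G ω⁆ ≤ ⁅K, K⁆ ⊔ K ⊓ L := by
      refine (Subgroup.commutator_mono le_rfl inf_le_left).trans ?_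
      refine Subgroup.commutator_le.2 fun k hk y hy => ?_
      obtain ⟨k', hk', l, hl, rfl⟩ := Subgroup.mem_sup_of_normal_left.1 hy
      have h1 : ⁅k, k'⁆ ∈ ⁅K, K⁆ := Subgroup.commutator_mem_commutator hk hk'
      have h2 : ⁅k, l⁆ ∈ K ⊓ L :=
        Subgroup.commutator_le_inf K L (Subgroup.commutator_mem_commutator hk hl)
      have := mul_mem (Subgroup.mem_sup_left (T := K ⊓ L) h1)
        (Subgroup.mem_sup_right (S := ⁅K, K⁆)
          ((inferInstance : (K ⊓ L).Normal).conj_mem _ h2 k'))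
      convert this using 1
      simp only [commutatorElement_def]
      group
    have hbot := hG.eq_bot_of_commutator_le hK.2.1 inferInstance (hK.2.2 _ inferInstance hlt)
      inf_le_right
      (fun h hh y hy => Subgroup.mem_inf.2
        ⟨(inferInstance : (K ⊔ L).Normal).conj_mem y hy.1 h,
          mul_mem (mul_mem hh hy.2) (inv_mem hh)⟩) hcomm
    refine hL.not_le hK hne.symm fun l hl => ?_
    obtain ⟨k, hk, hkl⟩ := hK.2.1 ω (l • ω)
    have hmem : k⁻¹ * l ∈ (K ⊔ L) ⊓ MulAction.stabilizer G ω :=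
      Subgroup.mem_inf.2
        ⟨mul_mem (inv_mem (Subgroup.mem_sup_left hk)) (Subgroup.mem_sup_right hl), by
          rw [MulAction.mem_stabilizer_iff, mul_smul, ← hkl, inv_smul_smul]⟩
    rw [hbot, Subgroup.mem_bot, inv_mul_eq_one] at hmem
    exact hmem ▸ hk
  · exact hG.eq_bot_of_commutator_le hK.2.1 (P := K ⊓ (L ⊔ R)) inferInstance
      (hK.2.2 _ inferInstance (inf_lt_left.2 hKR)) (Subgroup.map_subtype_le _) hRn
      ((Subgroup.commutator_mono le_rfl le_sup_right).trans (Subgroup.commutator_le_inf K _))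
end

section
/- Let G ≤ Sym(Ω) be a semiprimitive permutation group containing an element g that is a cycle of prime length p, i.e. the set of points of Ω moved by g has cardinality p and the cyclic group generated by g acts transitively on this set. Then G is primitive. -/
open Pointwise

/-- The action of `G` on `Ω` is primitive: transitive, and every `G`-invariant partition of
`Ω` is trivial. -/
def IsPrimitiveAction (G Ω : Type*) [Group G] [MulAction G Ω] : Prop :=
  (∀ a b : Ω, ∃ g : G, g • a = b) ∧
    ∀ P : Set (Set Ω), Setoid.IsPartition P → (∀ p ∈ P, ∀ g : G, g • p ∈ P) →
      (∀ p ∈ P, ∃ ω : Ω, p = {ω}) ∨ P = {Set.univ}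

/-- Two parts of a partition sharing a point are equal. -/
theorem Setoid.IsPartition.eq_of_common_mem {Ω : Type*} {P : Set (Set Ω)}
    (hP : Setoid.IsPartition P) {A B : Set Ω} (hA : A ∈ P) (hB : B ∈ P) {x : Ω}
    (hxA : x ∈ A) (hxB : x ∈ B) : A = B :=
  (hP.2 x).unique ⟨hA, hxA⟩ ⟨hB, hxB⟩

/-- The kernel of the action of `G` on a family of subsets of `Ω`: the elements of `G`
stabilising every member of the family. -/
def familyKernel (G : Type*) {Ω : Type*} [Group G] [MulAction G Ω] (P : Set (Set Ω)) :
    Subgroup G :=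
  ⨅ B ∈ P, MulAction.stabilizer G B

theorem mem_familyKernel {G Ω : Type*} [Group G] [MulAction G Ω] {P : Set (Set Ω)} {k : G} :
    k ∈ familyKernel G P ↔ ∀ B ∈ P, k • B = B := by
  simp [familyKernel, Subgroup.mem_iInf, MulAction.mem_stabilizer_iff]

theorem familyKernel_normal {G Ω : Type*} [Group G] [MulAction G Ω] {P : Set (Set Ω)}
    (hinv : ∀ B ∈ P, ∀ h : G, h • B ∈ P) : (familyKernel G P).Normal := by
  refine ⟨fun k hk h => mem_familyKernel.2 fun B hB => ?_⟩
  rw [mul_smul, mul_smul, mem_familyKernel.1 hk _ (hinv B hB h⁻¹), smul_inv_smul]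

/-- A partition whose parts are all stabilised by a transitive group has only one part. -/
theorem Setoid.IsPartition.eq_singleton_univ_of_familyKernel_transitive {G Ω : Type*} [Group G]
    [MulAction G Ω] [Nonempty Ω] {P : Set (Set Ω)} (hP : Setoid.IsPartition P)
    (htrans : ∀ a b : Ω, ∃ k ∈ familyKernel G P, k • a = b) : P = {Set.univ} := by
  have huniv : ∀ B ∈ P, B = Set.univ := by
    intro B hB
    obtain ⟨a, ha⟩ := Setoid.nonempty_of_mem_partition hP hB
    refine Set.eq_univ_of_forall fun b => ?_
    obtain ⟨k, hk, rfl⟩ := htrans a b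
    rw [← mem_familyKernel.1 hk B hB]
    exact Set.smul_mem_smul_set ha
  obtain ⟨B, ⟨hB, -⟩, -⟩ := hP.2 (Classical.arbitrary Ω)
  refine Set.eq_singleton_iff_unique_mem.2 ⟨?_, huniv⟩
  rwa [← huniv B hB]

/-- If a cycle `g` of prime length moves a part `B` of an invariant partition,
then `B` is a singleton. -/
theorem part_eq_singleton_of_smul_ne {G Ω : Type*} [Group G] [MulAction G Ω]
    {g : G} {p : ℕ} (hp : p.Prime) (hsupp : ({ω : Ω | g • ω ≠ ω}).ncard = p)
    (hcycle : ∀ a ∈ {ω : Ω | g • ω ≠ ω}, ∀ b ∈ {ω : Ω | g • ω ≠ ω}, ∃ n : ℤ, g ^ n • a = b)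
    {P : Set (Set Ω)} (hP : Setoid.IsPartition P) (hinv : ∀ B ∈ P, ∀ h : G, h • B ∈ P)
    {B : Set Ω} (hB : B ∈ P) (hgB : g • B ≠ B) {x : Ω} (hx : x ∈ B) : B = {x} := by
  have hsub : ∀ y ∈ B, g • y ≠ y := fun y hy hgy =>
    hgB (hP.eq_of_common_mem (hinv B hB g) hB (hgy ▸ Set.smul_mem_smul_set hy) hy)
  let H := Subgroup.zpowers g
  have horbit : MulAction.orbit H x = {ω : Ω | g • ω ≠ ω} := by
    ext y
    constructor
    · rintro ⟨⟨_, n, rfl⟩, rfl⟩ hy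
      refine hsub x hx ?_
      have hcomm : g • g ^ n • x = g ^ n • g • x := by
        rw [← mul_smul, ← mul_smul, (Commute.self_zpow g n).eq]
      exact smul_left_cancel (g ^ n) (hcomm.symm.trans hy)
    · intro hy
      obtain ⟨n, hn⟩ := hcycle x (hsub x hx) y hy
      exact ⟨⟨g ^ n, n, rfl⟩, hn⟩
  have hstab : ∀ h : H, h • x ∈ B → h • B = B := fun h hh =>
    hP.eq_of_common_mem (hinv B hB h) hB (Set.smul_mem_smul_set hx) hh
  have hle : MulAction.stabilizer H x ≤ MulAction.stabilizer H B := by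
    intro h hh
    rw [MulAction.mem_stabilizer_iff] at hh ⊢
    exact hstab h (hh.symm ▸ hx)
  have hindex : (MulAction.stabilizer H x).index = p := by
    rw [MulAction.index_stabilizer, horbit, hsupp]
  have hmul := Subgroup.relIndex_mul_index hle
  rw [hindex] at hmul
  rcases hp.eq_one_or_self_of_dvd _ (Dvd.intro_left _ hmul) with h1 | h1
  · rw [Subgroup.index_eq_one] at h1
    have hmem : (⟨g, Subgroup.mem_zpowers g⟩ : H) ∈ MulAction.stabilizer H B :=
      h1 ▸ Subgroup.mem_top _
    exact absurd (MulAction.mem_stabilizer_iff.1 hmem) hgB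
  · rw [h1] at hmul
    have hrel := Subgroup.relIndex_eq_one.1 (Nat.eq_of_mul_eq_mul_right hp.pos
      (hmul.trans (one_mul p).symm))
    refine Set.eq_singleton_iff_unique_mem.2 ⟨hx, fun y hy => ?_⟩
    have hy' : y ∈ MulAction.orbit H x := horbit ▸ hsub y hy
    obtain ⟨h, rfl⟩ := hy'
    exact MulAction.mem_stabilizer_iff.1 (hrel (MulAction.mem_stabilizer_iff.2 (hstab h hy)))

/-- A semiprimitive group `G ≤ Sym(Ω)` containing a cycle of prime length `p` (an element
whose support has exactly `p` points and which cycles them transitively) is primitive. -/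
theorem stmt14 {G Ω : Type*} [Group G] [MulAction G Ω] [FaithfulSMul G Ω]
    (hG : IsSemiprimitive G Ω) (g : G) (p : ℕ) (hp : p.Prime)
    (hsupp : ({ω : Ω | g • ω ≠ ω}).ncard = p)
    (hcycle : ∀ a ∈ {ω : Ω | g • ω ≠ ω}, ∀ b ∈ {ω : Ω | g • ω ≠ ω},
      ∃ n : ℤ, g ^ n • a = b) :
    IsPrimitiveAction G Ω := by
  have htrans : ∀ a b : Ω, ∃ h : G, h • a = b := fun a b =>
    let ⟨h, _, hh⟩ := hG.1 a b
    ⟨h, hh⟩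
  refine ⟨htrans, fun P hP hinv => ?_⟩
  obtain ⟨x₀, hx₀⟩ : ({ω : Ω | g • ω ≠ ω}).Nonempty :=
    Set.nonempty_of_ncard_ne_zero (hsupp ▸ hp.ne_zero)
  have : Nonempty Ω := ⟨x₀⟩
  by_cases hg : g ∈ familyKernel G P
  · right
    refine hP.eq_singleton_univ_of_familyKernel_transitive (G := G) ?_
    rcases hG.2 _ (familyKernel_normal hinv) with ht | hs
    · exact ht
    · have hmoved : ∀ a : Ω, g • a ≠ a := fun a ha =>
        hx₀ (by rw [hs g hg ⟨a, ha⟩, one_smul])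
      intro a b
      obtain ⟨n, hn⟩ := hcycle a (hmoved a) b (hmoved b)
      exact ⟨g ^ n, zpow_mem hg n, hn⟩
  · left
    rw [mem_familyKernel] at hg
    push Not at hg
    obtain ⟨B, hB, hgB⟩ := hg
    obtain ⟨x, hx⟩ := Setoid.nonempty_of_mem_partition hP hB
    have hBx := part_eq_singleton_of_smul_ne hp hsupp hcycle hP hinv hB hgB hx
    intro A hA
    obtain ⟨y, hy⟩ := Setoid.nonempty_of_mem_partition hP hA
    obtain ⟨h, rfl⟩ := htrans x y
    refine ⟨h • x, ?_⟩
    rw [hP.eq_of_common_mem hA (hinv B hB h) hy (Set.smul_mem_smul_set hx), hBx,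
      Set.smul_set_singleton]
end

section
/- Let n be a natural number and let G ≤ Sym(n) be a semiprimitive permutation group on an n-element set such that G does not contain the alternating group Alt(n). Then the index of G in Sym(n) satisfies |Sym(n) : G| ≥ ⌊(n+1)/2⌋!. -/
open Pointwise

/-- If the supports of `g` and `h` meet exactly in `a`, the commutator of `g` and `h` is a
3-cycle. -/
theorem Equiv.Perm.isThreeCycle_commutator {α : Type*} [Fintype α] [DecidableEq α]
    {g h : Equiv.Perm α} {a : α} (hg : g a ≠ a) (hh : h a ≠ a)
    (hgh : ∀ x, x ≠ a → g x = x ∨ h x = x) : (g * h * g⁻¹ * h⁻¹).IsThreeCycle := by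
  have hne : h a ≠ g a := by
    intro e
    rcases hgh (g a) hg with h1 | h1
    · exact hg (g.injective h1)
    · exact hh (h.injective (by rw [e, h1]))
  have key : g * h = Equiv.swap a (h a) * Equiv.swap a (g a) * (h * g) := by
    ext x
    have hgi := g.injective
    have hhi := h.injective
    have hx : x = a ∨ g x = x ∨ h x = x := or_iff_not_imp_left.mpr (hgh x)
    have hgx : g x = a ∨ g (g x) = g x ∨ h (g x) = g x := or_iff_not_imp_left.mpr (hgh (g x))
    have hhx : h x = a ∨ g (h x) = h x ∨ h (h x) = h x := or_iff_not_imp_left.mpr (hgh (h x))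
    have hga := (hgh (g a) hg).resolve_left fun e => hg (hgi e)
    have hha := (hgh (h a) hh).resolve_right fun e => hh (hhi e)
    simp only [Equiv.Perm.mul_apply, Equiv.swap_apply_def]
    split_ifs <;> grind [Function.Injective]
  have : g * h * g⁻¹ * h⁻¹ = Equiv.swap a (h a) * Equiv.swap a (g a) := by
    rw [key]; group
  rw [this]
  exact isThreeCycle_swap_mul_swap_same hh.symm hg.symm hne

/-- A 3-cycle preserves every block with at least two points. -/
theorem Equiv.Perm.IsThreeCycle.smul_block_eq {α : Type*} [Fintype α] [DecidableEq α]
    {G : Subgroup (Equiv.Perm α)} {c : G} (hc : (c : Equiv.Perm α).IsThreeCycle)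
    {B : Set α} (hB : MulAction.IsBlock G B) (hnt : B.Nontrivial) : c • B = B := by
  by_contra hne
  have hdisj := (MulAction.isBlock_iff_smul_eq_or_disjoint.mp hB c).resolve_left hne
  have hmem : ∀ x ∈ B, (c : Equiv.Perm α) x ∉ B := fun x hx hcx =>
    Set.disjoint_left.mp hdisj (Set.smul_mem_smul_set hx) hcx
  obtain ⟨a, ha, b, hb, hab⟩ := hnt
  have hsub : ({a, b, (c : Equiv.Perm α) a, (c : Equiv.Perm α) b} : Finset α) ⊆
      (c : Equiv.Perm α).support := by
    have := (c : Equiv.Perm α).injective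
    intro x hx
    simp only [Finset.mem_insert, Finset.mem_singleton] at hx
    rw [Equiv.Perm.mem_support]
    grind [Function.Injective]
  have hcard : ({a, b, (c : Equiv.Perm α) a, (c : Equiv.Perm α) b} : Finset α).card = 4 := by
    have := (c : Equiv.Perm α).injective
    repeat rw [Finset.card_insert_of_notMem (by
      simp only [Finset.mem_insert, Finset.mem_singleton]
      grind [Function.Injective])]
    rw [Finset.card_singleton]
  have := Finset.card_le_card hsub
  rw [hc.card_support] at this
  omega

/-- A semiprimitive group of degree at least 4 that contains a 3-cycle is primitive. -/
theorem IsSemiprimitive.isPreprimitive_of_isThreeCycle {α : Type*} [Fintype α] [DecidableEq α]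
    {G : Subgroup (Equiv.Perm α)} (hG : IsSemiprimitive G α) (hα : 3 < Fintype.card α)
    {c : G} (hc : (c : Equiv.Perm α).IsThreeCycle) : MulAction.IsPreprimitive G α := by
  have : MulAction.IsPretransitive G α := ⟨fun x y => by
    obtain ⟨g, -, hg⟩ := hG.1 x y
    exact ⟨g, hg⟩⟩
  refine ⟨fun {B} hB => ?_⟩
  rw [MulAction.IsTrivialBlock, or_iff_not_imp_left, Set.not_subsingleton_iff]
  intro hnt
  have hcN : c ∈ (MulAction.stabilizer G B).normalCore := fun g => by
    have : ((g * c * g⁻¹ : G) : Equiv.Perm α).IsThreeCycle := by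
      rw [Equiv.Perm.IsThreeCycle] at hc ⊢
      push_cast
      rw [Equiv.Perm.cycleType_conj, hc]
    exact this.smul_block_eq hB hnt
  rcases hG.2 _ (Subgroup.normalCore_normal (MulAction.stabilizer G B)) with ht | hs
  · obtain ⟨b, hb⟩ := hnt.nonempty
    refine Set.eq_univ_of_forall fun x => ?_
    obtain ⟨g, hg, rfl⟩ := ht b x
    rw [← (Subgroup.normalCore_le _ hg : g • B = B)]
    exact Set.smul_mem_smul_set hb
  · obtain ⟨x, -, hx⟩ := Finset.exists_mem_notMem_of_card_lt_card
      (s := (c : Equiv.Perm α).support) (t := Finset.univ)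
      (by rwa [hc.card_support, Finset.card_univ])
    have h1 : c = 1 := hs c hcN ⟨x, Equiv.Perm.notMem_support.mp hx⟩
    have := hc.card_support
    simp [h1] at this

/-- If only the identity of `G` fixes `s` pointwise, then `G` has index at least `|sᶜ|!`. -/
theorem Subgroup.factorial_card_compl_le_index {α : Type*} [Fintype α] [DecidableEq α]
    (G : Subgroup (Equiv.Perm α)) (s : Finset α)
    (hs : ∀ g ∈ G, (∀ x ∈ s, g x = x) → g = 1) : (sᶜ.card).factorial ≤ G.index := by
  have hinj : Function.Injective fun e : Equiv.Perm (sᶜ : Finset α) =>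
      ((Equiv.Perm.ofSubtype e : Equiv.Perm α) : Equiv.Perm α ⧸ G) := by
    intro e f hef
    have hmem := QuotientGroup.eq.mp hef
    rw [← map_inv, ← map_mul] at hmem
    have h1 := hs _ hmem fun x hx =>
      Equiv.Perm.ofSubtype_apply_of_not_mem _ (by simpa using hx)
    rw [map_eq_one_iff _ Equiv.Perm.ofSubtype_injective] at h1
    exact inv_mul_eq_one.mp h1
  have := Nat.card_le_card_of_injective _ hinj
  rwa [Nat.card_perm, Nat.card_eq_fintype_card, Fintype.card_coe] at this

/-- A permutation group without 3-cycles has a base of at most half the degree. -/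
theorem Subgroup.exists_base_two_mul_card_le {α : Type*} [Fintype α] [DecidableEq α]
    (G : Subgroup (Equiv.Perm α)) (hG : ∀ c ∈ G, ¬ c.IsThreeCycle) :
    ∃ s : Finset α, (∀ g ∈ G, (∀ x ∈ s, g x = x) → g = 1) ∧ 2 * s.card ≤ Fintype.card α := by
  classical
  obtain ⟨s, hs, hmin⟩ := Finset.exists_min_image
    (Finset.univ.filter fun s : Finset α => ∀ g ∈ G, (∀ x ∈ s, g x = x) → g = 1) Finset.card
    ⟨Finset.univ, by
      simp only [Finset.mem_filter, Finset.mem_univ, true_and]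
      exact fun g _ hg => Equiv.ext fun x => hg x trivial⟩
  simp only [Finset.mem_filter, Finset.mem_univ, true_and] at hs hmin
  refine ⟨s, hs, ?_⟩
  by_contra! hlt
  have hnot : ∀ t : Finset α, t.card < s.card →
      ∃ g ∈ G, (∀ x ∈ t, g x = x) ∧ g ≠ 1 := by
    intro t ht
    by_contra! h
    exact absurd (hmin t h) (by omega)
  obtain ⟨g, hgG, hgfix, hg1⟩ := hnot sᶜ (by rw [Finset.card_compl]; omega)
  obtain ⟨a, ha⟩ : ∃ a, g a ≠ a := by
    by_contra! h
    exact hg1 (Equiv.ext h)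
  have has : a ∈ s := by
    by_contra h
    exact ha (hgfix a (Finset.mem_compl.mpr h))
  obtain ⟨h, hhG, hhfix, hh1⟩ := hnot (s.erase a) (Finset.card_erase_lt_of_mem has)
  have hha : h a ≠ a := fun e => hh1 <| hs h hhG fun x hx => by
    rcases eq_or_ne x a with rfl | hxa
    · exact e
    · exact hhfix x (Finset.mem_erase.mpr ⟨hxa, hx⟩)
  refine hG _ (mul_mem (mul_mem (mul_mem hgG hhG) (inv_mem hgG)) (inv_mem hhG))
    (Equiv.Perm.isThreeCycle_commutator ha hha fun x hxa => ?_)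
  by_cases hx : x ∈ s
  · exact Or.inr (hhfix x (Finset.mem_erase.mpr ⟨hxa, hx⟩))
  · exact Or.inl (hgfix x (Finset.mem_compl.mpr hx))

/-- A semiprimitive group `G ≤ Sym(n)` not containing `Alt(n)` satisfies
`|Sym(n) : G| ≥ ⌊(n+1)/2⌋!`. -/
theorem stmt15 (n : ℕ) (G : Subgroup (Equiv.Perm (Fin n)))
    (hG : IsSemiprimitive ↥G (Fin n))
    (halt : ¬ alternatingGroup (Fin n) ≤ G) :
    Nat.factorial ((n + 1) / 2) ≤ G.index := by
  rcases Nat.lt_or_ge 3 n with hn | hn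
  · have hno : ∀ c ∈ G, ¬ c.IsThreeCycle := fun c hcG hc => halt <| by
      have := hG.isPreprimitive_of_isThreeCycle (by simpa using hn) (c := ⟨c, hcG⟩) hc
      exact Equiv.Perm.alternatingGroup_le_of_isPreprimitive_of_isThreeCycle_mem this hc hcG
    obtain ⟨s, hs, hcard⟩ := G.exists_base_two_mul_card_le hno
    refine le_trans (Nat.factorial_le ?_) (G.factorial_card_compl_le_index s hs)
    rw [Finset.card_compl]
    rw [Fintype.card_fin] at hcard ⊢
    omega
  · have hindex : 2 ≤ G.index := by
      have h0 : G.index ≠ 0 := Subgroup.index_ne_zero_of_finite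
      have h1 : G.index ≠ 1 := fun h => halt (by rw [Subgroup.index_eq_one.mp h]; exact le_top)
      omega
    exact le_trans (Nat.factorial_le (by omega : (n + 1) / 2 ≤ 2)) hindex
end

section
/- Let Γ be a connected simple graph that is not bipartite (i.e. not 2-colourable), and let G ≤ Aut(Γ) be a vertex-transitive group of automorphisms such that for every vertex x, the permutation group induced by the stabiliser G_x on the neighbourhood Γ(x) of x is quasiprimitive (every non-trivial normal subgroup of the induced group is transitive on Γ(x)). Then G is semiprimitive on the vertex set of Γ. -/
open Pointwise

/-- In a connected graph, a property of vertices that passes to neighbours and holds somewhere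
holds everywhere. -/
theorem SimpleGraph.Connected.forall_of_adj {V : Type*} {Γ : SimpleGraph V} (hconn : Γ.Connected)
    {p : V → Prop} (hp : ∀ u v, Γ.Adj u v → p u → p v) {a : V} (ha : p a) (b : V) : p b := by
  obtain ⟨w⟩ := hconn.preconnected a b
  induction w with
  | nil => exact ha
  | cons h _ ih => exact ih (hp _ _ h ha)

section NormalSubgroup

variable {V : Type*} {Γ : SimpleGraph V} {G : Type*} [Group G] [MulAction G V]

/-- If the vertex stabilisers in `N` fix all neighbours of the vertex, then `N` is semiregular. -/
theorem isSemiregularOn_of_fixes_neighbors [FaithfulSMul G V] (hconn : Γ.Connected)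
    {N : Subgroup G}
    (hfix : ∀ n ∈ N, ∀ x : V, n • x = x → ∀ v, Γ.Adj x v → n • v = v) :
    IsSemiregularOn N V := by
  rintro n hn ⟨a, ha⟩
  refine FaithfulSMul.eq_of_smul_eq_smul (α := V) fun b => ?_
  rw [one_smul]
  exact hconn.forall_of_adj (p := fun b => n • b = b) (fun u v h hu => hfix n hn u hu v h) ha b

/-- For a normal subgroup `N` of a vertex-transitive group of automorphisms, if some vertex
stabiliser in `N` moves a neighbour of its vertex, then all of them do. -/
theorem exists_stabilizer_moves_neighbor
    (hadj : ∀ (g : G) (u v : V), Γ.Adj u v ↔ Γ.Adj (g • u) (g • v))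
    (hvt : ∀ u v : V, ∃ g : G, g • u = v) {N : Subgroup G} (hN : N.Normal)
    {n : G} (hn : n ∈ N) {x v : V} (hx : n • x = x) (hv : Γ.Adj x v) (hne : n • v ≠ v) (y : V) :
    ∃ m ∈ N, m • y = y ∧ ∃ w, Γ.Adj y w ∧ m • w ≠ w := by
  obtain ⟨g, rfl⟩ := hvt x y
  refine ⟨g * n * g⁻¹, hN.conj_mem n hn g, by simp [mul_smul, hx], g • v,
    (hadj g x v).1 hv, ?_⟩
  simpa [mul_smul] using hne

/-- If the vertex stabilisers in `N` are transitive on neighbourhoods, then `N` has at most two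
orbits, represented by the ends of any edge. -/
theorem exists_smul_eq_or_of_adj (hconn : Γ.Connected)
    (hadj : ∀ (g : G) (u v : V), Γ.Adj u v ↔ Γ.Adj (g • u) (g • v)) {N : Subgroup G}
    (hloc : ∀ x u v : V, Γ.Adj x u → Γ.Adj x v → ∃ n ∈ N, n • u = v)
    {u v : V} (huv : Γ.Adj u v) (w : V) :
    (∃ n ∈ N, n • u = w) ∨ ∃ n ∈ N, n • v = w := by
  have step : ∀ {a b c d : V}, Γ.Adj a b → Γ.Adj c d → (∃ n ∈ N, n • a = c) →
      ∃ n ∈ N, n • b = d := by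
    rintro a b _ d hab hcd ⟨n, hn, rfl⟩
    obtain ⟨m, hm, h⟩ := hloc (n • a) (n • b) d ((hadj n a b).1 hab) hcd
    exact ⟨m * n, N.mul_mem hm hn, by rw [mul_smul, h]⟩
  exact hconn.forall_of_adj
    (p := fun w => (∃ n ∈ N, n • u = w) ∨ ∃ n ∈ N, n • v = w)
    (fun c d hcd h => h.symm.imp (step huv.symm hcd) (step huv hcd))
    (Or.inl ⟨1, N.one_mem, one_smul _ _⟩) w

/-- On a connected non-bipartite graph, a group of automorphisms whose vertex stabilisers are
transitive on neighbourhoods is vertex-transitive. -/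
theorem isTransitiveOn_of_locally_transitive (hconn : Γ.Connected) (hnotbip : ¬ Γ.Colorable 2)
    (hadj : ∀ (g : G) (u v : V), Γ.Adj u v ↔ Γ.Adj (g • u) (g • v)) {N : Subgroup G}
    (hloc : ∀ x u v : V, Γ.Adj x u → Γ.Adj x v → ∃ n ∈ N, n • u = v) :
    IsTransitiveOn N V := by
  have symm : ∀ {a b : V}, (∃ n ∈ N, n • a = b) → ∃ n ∈ N, n • b = a := by
    rintro a _ ⟨n, hn, rfl⟩
    exact ⟨n⁻¹, N.inv_mem hn, inv_smul_smul _ _⟩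
  have trans : ∀ {a b c : V}, (∃ n ∈ N, n • a = b) → (∃ n ∈ N, n • b = c) →
      ∃ n ∈ N, n • a = c := by
    rintro a _ _ ⟨n, hn, rfl⟩ ⟨m, hm, rfl⟩
    exact ⟨m * n, N.mul_mem hm hn, mul_smul _ _ _⟩
  intro a b
  by_contra hab
  let c : Γ.Coloring Prop := SimpleGraph.Coloring.mk (fun w => ∃ n ∈ N, n • a = w) (by
    intro u v huv heq
    have hiff := iff_of_eq heq
    have key := exists_smul_eq_or_of_adj hconn hadj hloc huv
    by_cases hu : ∃ n ∈ N, n • a = u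
    · exact hab ((key b).elim (trans hu) (trans (hiff.1 hu)))
    · exact (key a).elim (fun h => hu (symm h)) fun h => hu (hiff.2 (symm h)))
  exact hnotbip (by simpa using c.colorable)

end NormalSubgroup

/-- Let `Γ` be a connected non-bipartite graph and let `G ≤ Aut(Γ)` be vertex-transitive and
locally quasiprimitive (for each vertex `x`, the permutation group induced by `G_x` on the
neighbourhood `Γ(x)` is quasiprimitive).  Then `G` is semiprimitive on the vertex set. -/
theorem stmt16 {V : Type*} (Γ : SimpleGraph V) (hconn : Γ.Connected)
    (hnotbip : ¬ Γ.Colorable 2)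
    {G : Type*} [Group G] [MulAction G V] [FaithfulSMul G V]
    -- G acts on Γ by automorphisms
    (hadj : ∀ (g : G) (u v : V), Γ.Adj u v ↔ Γ.Adj (g • u) (g • v))
    -- G is vertex-transitive
    (hvt : ∀ u v : V, ∃ g : G, g • u = v)
    -- the induced action of G_x on Γ(x) is transitive
    (hloctrans : ∀ x : V, ∀ u ∈ Γ.neighborSet x, ∀ v ∈ Γ.neighborSet x,
      ∃ g ∈ MulAction.stabilizer G x, g • u = v)
    -- every normal subgroup of G_x inducing a non-trivial group on Γ(x) is transitive
    -- on Γ(x); i.e. the induced group on Γ(x) is quasiprimitive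
    (hlocqp : ∀ x : V, ∀ N : Subgroup ↥(MulAction.stabilizer G x), N.Normal →
      (∃ n ∈ N, ∃ v ∈ Γ.neighborSet x, (n : G) • v ≠ v) →
      ∀ u ∈ Γ.neighborSet x, ∀ v ∈ Γ.neighborSet x, ∃ n ∈ N, (n : G) • u = v) :
    IsSemiprimitive G V := by
  refine ⟨fun a b => (hvt a b).imp fun g hg => ⟨Subgroup.mem_top g, hg⟩, fun N hN => ?_⟩
  by_cases hfix : ∀ n ∈ N, ∀ x : V, n • x = x → ∀ v, Γ.Adj x v → n • v = v
  · exact Or.inr (isSemiregularOn_of_fixes_neighbors hconn hfix)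
  · push Not at hfix
    obtain ⟨n, hn, x, hx, v, hv, hne⟩ := hfix
    refine Or.inl (isTransitiveOn_of_locally_transitive hconn hnotbip hadj fun y u w hu hw => ?_)
    obtain ⟨m, hm, hy, z, hz, hmz⟩ := exists_stabilizer_moves_neighbor hadj hvt hN hn hx hv hne y
    obtain ⟨k, hk, hkw⟩ := hlocqp y (N.subgroupOf (MulAction.stabilizer G y)) inferInstance
      ⟨⟨m, hy⟩, Subgroup.mem_subgroupOf.2 hm, z, hz, hmz⟩ u hu w hw
    exact ⟨k, Subgroup.mem_subgroupOf.1 hk, hkw⟩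
end

section
/- Let M be a perfect group and I a set, and let res(M^I) denote the subgroup of the direct product ∏_{i∈I} M consisting of the finitely supported elements (functions f : I → M with f(i) = 1 for all but finitely many i). If D is a normal subgroup of res(M^I) such that for every i ∈ I the image of D under the i-th coordinate projection is all of M, then D = res(M^I). -/
/-- The restricted direct product `res(M^I)`: the subgroup of `∏_{i ∈ I} M` consisting of
the finitely supported functions. -/
def resProd (I M : Type*) [Group M] : Subgroup (I → M) where
  carrier := {f | {i | f i ≠ 1}.Finite}
  one_mem' := by
    simp only [Set.mem_setOf_eq, Pi.one_apply, ne_eq, not_true_eq_false, Set.setOf_false]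
    exact Set.finite_empty
  mul_mem' := by
    intro a b ha hb
    refine (ha.union hb).subset fun i hi => ?_
    simp only [Set.mem_setOf_eq, Pi.mul_apply, ne_eq] at hi
    simp only [Set.mem_union, Set.mem_setOf_eq, ne_eq]
    by_contra h
    push_neg at h
    exact hi (by rw [h.1, h.2, one_mul])
  inv_mem' := by
    intro a ha
    refine ha.subset fun i hi => ?_
    simp only [Set.mem_setOf_eq, Pi.inv_apply, ne_eq, inv_eq_one] at hi
    exact hi

open Classical in
/-- The embedding of `M` as the `i`-th factor of `res(M^I)`. -/
noncomputable def resProdSingle {I : Type*} (M : Type*) [Group M] (i : I) :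
    M →* ↥(resProd I M) :=
  (MonoidHom.mulSingle (fun _ : I => M) i).codRestrict (resProd I M) fun m =>
    (Set.finite_singleton i).subset fun j hj => by
      by_contra hji
      exact hj (Pi.mulSingle_eq_of_ne (M := fun _ => M) hji m)

open Classical in
theorem coe_resProdSingle {I M : Type*} [Group M] (i : I) (m : M) :
    (resProdSingle M i m : I → M) = Pi.mulSingle i m :=
  rfl

open scoped commutatorElement in
/-- The commutator of a finitely supported function with an element of the `i`-th factor is
the commutator in that factor. -/
theorem commutatorElement_resProdSingle {I M : Type*} [Group M] (f : ↥(resProd I M)) (i : I)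
    (m : M) : ⁅f, resProdSingle M i m⁆ = resProdSingle M i ⁅(f : I → M) i, m⁆ := by
  classical
  ext j
  rcases eq_or_ne j i with rfl | hj
  · simp [commutatorElement_def, coe_resProdSingle]
  · simp [commutatorElement_def, coe_resProdSingle, hj]

/-- A normal subgroup of `res(M^I)` that projects onto the `i`-th factor contains the
commutator subgroup of that factor. -/
theorem commutator_le_comap_resProdSingle {I M : Type*} [Group M]
    (D : Subgroup ↥(resProd I M)) [D.Normal] (i : I)
    (hproj : ∀ m : M, ∃ f ∈ D, (f : I → M) i = m) :
    commutator M ≤ D.comap (resProdSingle M i) := by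
  rw [commutator_def, Subgroup.commutator_le]
  rintro a - b -
  obtain ⟨f, hf, rfl⟩ := hproj a
  rw [Subgroup.mem_comap, ← commutatorElement_resProdSingle]
  exact Subgroup.commutator_le_left D ⊤ (Subgroup.commutator_mem_commutator hf trivial)

/-- The factors generate `res(M^I)`. -/
theorem eq_top_of_resProdSingle_mem {I M : Type*} [Group M] (D : Subgroup ↥(resProd I M))
    (h : ∀ i m, resProdSingle M i m ∈ D) : D = ⊤ := by
  classical
  have key : ∀ (s : Finset I) (f : ↥(resProd I M)),
      (∀ i, i ∉ s → (f : I → M) i = 1) → f ∈ D := by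
    intro s
    induction s using Finset.induction_on with
    | empty =>
      intro f hf
      have : f = 1 := by
        ext i
        exact hf i (Finset.notMem_empty i)
      exact this ▸ D.one_mem
    | insert a s ha ih =>
      intro f hf
      rw [← D.mul_mem_cancel_left (h a ((f : I → M) a)⁻¹)]
      refine ih _ fun i hi => ?_
      rcases eq_or_ne i a with rfl | hia
      · simp [coe_resProdSingle]
      · simp [coe_resProdSingle, hia, hf i (by simp [hia, hi])]
  refine (Subgroup.eq_top_iff' D).2 fun f => ?_
  have hf : {i | (f : I → M) i ≠ 1}.Finite := f.2
  exact key hf.toFinset f fun i hi => by simpa using hi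

/-- If `M` is a perfect group and `D` is a normal subgroup of `res(M^I)` whose image under
every coordinate projection is all of `M`, then `D = res(M^I)`. -/
theorem stmt17 {M : Type*} [Group M] (hperf : commutator M = ⊤) (I : Type*)
    (D : Subgroup ↥(resProd I M)) (hD : D.Normal)
    (hproj : ∀ (i : I) (m : M), ∃ f ∈ D, ((f : I → M)) i = m) :
    D = ⊤ := by
  refine eq_top_of_resProdSingle_mem D fun i m => ?_
  exact commutator_le_comap_resProdSingle D i (hproj i) (hperf ▸ Subgroup.mem_top m)
end

section
/- Let (K,H,L) be a semiprimitive triple: K is a group, H ≤ Aut(K) is a group of automorphisms of K such that for every proper H-invariant normal subgroup Y of K the induced action of H on K/Y is faithful; setting K₀ = {k ∈ K : the inner automorphism c_k lies in H}, L is a normal subgroup of K₀ that is core-free in K and invariant under H, and if L ≠ 1 then K is perfect; and K ≠ LR for every proper H-invariant normal subgroup R of K. Let X = K ⋊ H be the semidirect product (H acting on K as automorphisms), identify K and H with their images in X, let Y = HL ≤ X, and let Z = {(c_{u^{-1}}, u) : u ∈ L} ≤ X. Then Z is exactly the kernel of the action of X by right multiplication on the set of right cosets of Y in X, and the induced faithful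 action of X/Z on these cosets is semiprimitive with point-stabiliser YZ/Z = HZ/Z ≅ H and with plinth KZ/Z ≅ K; moreover KZ/Z ∩ HZ/Z = LZ/Z ≅ L. -/
/-- If the image of `f` meets the normal subgroup `Z` trivially and `f` is injective, then
`(f.range ⊔ Z) / Z` is isomorphic to the domain of `f`. -/
theorem MonoidHom.exists_surjective_of_range_sup {G X : Type*} [Group G] [Group X]
    (f : G →* X) (Z : Subgroup X) [hZ : Z.Normal] (hf : ∀ g, f g ∈ Z → g = 1)
    (W : Subgroup X) (hW : W = f.range ⊔ Z) :
    ∃ ψ : ↥W →* G, Function.Surjective ψ ∧ ∀ x : ↥W, ψ x = 1 ↔ (x : X) ∈ Z := by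
  have hfW : ∀ g, f g ∈ W := fun g => hW ▸ Subgroup.mem_sup_left ⟨g, rfl⟩
  let e : G →* ↥W ⧸ Z.subgroupOf W := (QuotientGroup.mk' _).comp (f.codRestrict W hfW)
  have he : Function.Bijective e := by
    constructor
    · refine (injective_iff_map_eq_one e).2 fun g hg => hf g ?_
      exact Subgroup.mem_subgroupOf.1 ((QuotientGroup.eq_one_iff _).1 hg)
    · intro q
      obtain ⟨⟨x, hx⟩, rfl⟩ := QuotientGroup.mk_surjective q
      obtain ⟨_, ⟨g, rfl⟩, z, hz, rfl⟩ := Subgroup.mem_sup_of_normal_right.1 (hW ▸ hx)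
      refine ⟨g, QuotientGroup.eq.2 (Subgroup.mem_subgroupOf.2 ?_)⟩
      simpa using hz
  let E := MulEquiv.ofBijective e he
  refine ⟨E.symm.toMonoidHom.comp (QuotientGroup.mk' _),
    E.symm.surjective.comp (QuotientGroup.mk'_surjective _), fun x => ?_⟩
  change E.symm (x : ↥W ⧸ Z.subgroupOf W) = 1 ↔ _
  rw [EmbeddingLike.map_eq_one_iff, QuotientGroup.eq_one_iff, Subgroup.mem_subgroupOf]

/-- A subgroup `R` acts transitively on the left cosets of `Y` iff `R * Y` is everything. -/
theorem Subgroup.forall_exists_smul_eq_iff {X : Type*} [Group X] (R Y : Subgroup X) :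
    (∀ a b : X ⧸ Y, ∃ r ∈ R, r • a = b) ↔ ∀ x : X, ∃ r ∈ R, r⁻¹ * x ∈ Y := by
  constructor
  · intro h x
    obtain ⟨r, hr, he⟩ := h (QuotientGroup.mk 1) (QuotientGroup.mk x)
    refine ⟨r, hr, ?_⟩
    rw [MulAction.Quotient.smul_mk, QuotientGroup.eq] at he
    simpa using he
  · intro h a b
    obtain ⟨x, rfl⟩ := QuotientGroup.mk_surjective a
    obtain ⟨y, rfl⟩ := QuotientGroup.mk_surjective b
    obtain ⟨r, hr, hrx⟩ := h x
    obtain ⟨s, hs, hsy⟩ := h y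
    refine ⟨s * r⁻¹, R.mul_mem hs (R.inv_mem hr), ?_⟩
    rw [MulAction.Quotient.smul_mk, QuotientGroup.eq]
    have := Y.mul_mem (Y.inv_mem hrx) hsy
    simpa [mul_assoc] using this

namespace SemidirectProduct

variable {K : Type*} [Group K] {H : Subgroup (MulAut K)}

/-- The trace on `K` of a normal subgroup of `K ⋊ H` is `H`-invariant. -/
theorem apply_mem_comap_inl (R : Subgroup (K ⋊[H.subtype] ↥H)) [hR : R.Normal]
    {h : MulAut K} (hh : h ∈ H) {k : K}
    (hk : k ∈ R.comap (inl : K →* K ⋊[H.subtype] ↥H)) :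
    h k ∈ R.comap (inl : K →* K ⋊[H.subtype] ↥H) := by
  have := hR.conj_mem _ hk (inr ⟨h, hh⟩)
  rwa [← map_inv, ← inl_aut] at this

/-- If an element of `H` lies in a normal subgroup `R` of `K ⋊ H`, then it acts trivially
modulo the trace of `R` on `K`. -/
theorem apply_mul_inv_mem_comap_inl (R : Subgroup (K ⋊[H.subtype] ↥H)) [hR : R.Normal]
    {h : ↥H} (hh : inr h ∈ R) (k : K) :
    (h : MulAut K) k * k⁻¹ ∈ R.comap (inl : K →* K ⋊[H.subtype] ↥H) := by
  have h1 := R.mul_mem hh (hR.conj_mem _ (R.inv_mem hh) (inl k))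
  have h2 : (inr h : K ⋊[H.subtype] ↥H) * (inl k * (inr h)⁻¹ * (inl k)⁻¹) =
      inl ((h : MulAut K) k * k⁻¹) := by
    ext <;> simp
  rwa [h2] at h1

/-- If `L` is `H`-invariant, then `HL` consists of the elements with `K`-component in `L`. -/
theorem mem_map_inl_sup_range_inr {L : Subgroup K} (hLH : ∀ h ∈ H, ∀ l ∈ L, h l ∈ L)
    (x : K ⋊[H.subtype] ↥H) :
    x ∈ L.map (inl : K →* K ⋊[H.subtype] ↥H) ⊔ (inr : ↥H →* K ⋊[H.subtype] ↥H).range ↔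
      x.left ∈ L := by
  constructor
  · intro hx
    let S : Subgroup (K ⋊[H.subtype] ↥H) :=
      { carrier := {y | y.left ∈ L}
        one_mem' := L.one_mem
        mul_mem' := fun {a b} ha hb => L.mul_mem ha (hLH _ a.right.2 _ hb)
        inv_mem' := fun {a} ha => hLH _ (a.right⁻¹).2 _ (L.inv_mem ha) }
    have hS : L.map (inl : K →* K ⋊[H.subtype] ↥H) ⊔
        (inr : ↥H →* K ⋊[H.subtype] ↥H).range ≤ S := by
      refine sup_le ?_ ?_
      · rintro _ ⟨l, hl, rfl⟩
        exact hl
      · rintro _ ⟨h, rfl⟩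
        exact L.one_mem
    exact hS hx
  · intro hx
    rw [← inl_left_mul_inr_right x]
    exact Subgroup.mul_mem _ (Subgroup.mem_sup_left ⟨_, hx, rfl⟩)
      (Subgroup.mem_sup_right ⟨_, rfl⟩)

section AntiDiagonal

variable {L : Subgroup K} {Z : Subgroup (K ⋊[H.subtype] ↥H)}

/-- The subgroup `{(c_{u⁻¹}, u) : u ∈ L}` is normal in `K ⋊ H` when `L` is `H`-invariant. -/
theorem normal_of_mem_iff_conj (hLH : ∀ h ∈ H, ∀ l ∈ L, h l ∈ L)
    (hZ : ∀ x : K ⋊[H.subtype] ↥H,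
      x ∈ Z ↔ x.left ∈ L ∧ ∀ k : K, (x.right : MulAut K) k = x.left⁻¹ * k * x.left) :
    Z.Normal := by
  refine ⟨fun z hz x => ?_⟩
  obtain ⟨hzL, hzc⟩ := (hZ z).1 hz
  have hleft : (x * z * x⁻¹).left = (x.right : MulAut K) z.left := by
    simp [hzc, mul_assoc]
  rw [hZ, hleft]
  refine ⟨hLH _ x.right.2 _ hzL, fun k => ?_⟩
  simp [hzc]

/-- Every element of `HL` is congruent to an element of `H` modulo `Z`. -/
theorem exists_inr_mul_eq (hLK0 : L ≤ H.comap (MulAut.conj : K →* MulAut K))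
    (hZ : ∀ x : K ⋊[H.subtype] ↥H,
      x ∈ Z ↔ x.left ∈ L ∧ ∀ k : K, (x.right : MulAut K) k = x.left⁻¹ * k * x.left)
    {x : K ⋊[H.subtype] ↥H} (hx : x.left ∈ L) : ∃ h : ↥H, ∃ z ∈ Z, z * inr h = x := by
  let c : ↥H := ⟨MulAut.conj x.left, hLK0 hx⟩
  refine ⟨c * x.right, inl x.left * inr c⁻¹, ?_, ?_⟩
  · rw [hZ]
    simp [c, hx]
  · ext <;> simp

/-- If `L` is core-free in `K`, then `K` meets `Z` trivially. -/
theorem eq_one_of_inl_mem (hLcf : L.normalCore = ⊥)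
    (hZ : ∀ x : K ⋊[H.subtype] ↥H,
      x ∈ Z ↔ x.left ∈ L ∧ ∀ k : K, (x.right : MulAut K) k = x.left⁻¹ * k * x.left)
    {k : K} (hk : inl k ∈ Z) : k = 1 := by
  obtain ⟨hkL, hkc⟩ := (hZ _).1 hk
  rw [← Subgroup.mem_bot, ← hLcf]
  intro g
  have hg : g = k⁻¹ * g * k := by simpa using hkc g
  have : g * k * g⁻¹ = k := by
    rw [mul_inv_eq_iff_eq_mul]
    nth_rewrite 2 [hg]
    group
  rwa [this]

end AntiDiagonal

end SemidirectProduct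

open SemidirectProduct in
/-- Construction of a semiprimitive group from a semiprimitive triple `(K, H, L)`:
`H ≤ Aut(K)` acts faithfully on every non-trivial `H`-invariant quotient of `K`;
`L` is an `H`-invariant core-free normal subgroup of `K₀ = {k ∈ K : c_k ∈ H}`, with `K`
perfect if `L ≠ 1`; and `K ≠ LR` for every proper `H`-invariant normal subgroup `R` of `K`.
With `X = K ⋊ H`, `Y = HL` and `Z = {(c_{u⁻¹}, u) : u ∈ L}`, the subgroup `Z` is exactly
the kernel of the action of `X` on the coset space of `Y`, and the induced faithful action
of `X/Z` on this coset space is semiprimitive with point-stabiliser `Y/Z = HZ/Z ≅ H` and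
plinth `KZ/Z ≅ K`; moreover `KZ/Z ∩ HZ/Z = LZ/Z ≅ L`. -/
theorem stmt19 {K : Type*} [Group K] (H : Subgroup (MulAut K))
    -- (1): H acts faithfully on each non-trivial H-invariant quotient of K
    (hfaith : ∀ Y : Subgroup K, Y.Normal → (∀ h ∈ H, ∀ y ∈ Y, h y ∈ Y) → Y < ⊤ →
      ∀ h ∈ H, (∀ k : K, h k * k⁻¹ ∈ Y) → h = 1)
    (L : Subgroup K)
    -- (2): L is a normal subgroup of K₀ = {k : c_k ∈ H}, core-free in K, H-invariant,
    -- and K is perfect if L is non-trivial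
    (hLK0 : L ≤ Subgroup.comap (MulAut.conj : K →* MulAut K) H)
    (hLnrm : ∀ k ∈ Subgroup.comap (MulAut.conj : K →* MulAut K) H, ∀ l ∈ L, k * l * k⁻¹ ∈ L)
    (hLcf : L.normalCore = ⊥)
    (hLH : ∀ h ∈ H, ∀ l ∈ L, h l ∈ L)
    (hLperf : L ≠ ⊥ → ⁅(⊤ : Subgroup K), (⊤ : Subgroup K)⁆ = (⊤ : Subgroup K))
    -- (3): K ≠ LR for every proper H-invariant normal subgroup R of K
    (hnogen : ∀ R : Subgroup K, R.Normal → (∀ h ∈ H, ∀ r ∈ R, h r ∈ R) → R < ⊤ →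
      L ⊔ R ≠ ⊤)
    -- Y = HL ≤ X = K ⋊ H
    (Y : Subgroup (K ⋊[H.subtype] ↥H))
    (hY : Y = L.map (SemidirectProduct.inl : K →* K ⋊[H.subtype] ↥H) ⊔
      (SemidirectProduct.inr : ↥H →* K ⋊[H.subtype] ↥H).range)
    -- Z = {(c_{u⁻¹}, u) : u ∈ L}
    (Z : Subgroup (K ⋊[H.subtype] ↥H))
    (hZ : ∀ x : K ⋊[H.subtype] ↥H,
      x ∈ Z ↔ x.left ∈ L ∧ ∀ k : K, (x.right : MulAut K) k = x.left⁻¹ * k * x.left)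
    -- KZ and LZ
    (KZ : Subgroup (K ⋊[H.subtype] ↥H))
    (hKZ : KZ = (SemidirectProduct.inl : K →* K ⋊[H.subtype] ↥H).range ⊔ Z)
    (LZ : Subgroup (K ⋊[H.subtype] ↥H))
    (hLZ : LZ = L.map (SemidirectProduct.inl : K →* K ⋊[H.subtype] ↥H) ⊔ Z) :
    -- Z is the kernel of the action of X on the cosets of Y
    Z = Y.normalCore ∧
    -- X/Z is transitive on the cosets of Y
    (∀ a b : (K ⋊[H.subtype] ↥H) ⧸ Y, ∃ x : K ⋊[H.subtype] ↥H, x • a = b) ∧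
    -- X/Z is semiprimitive on the cosets of Y: every normal subgroup of X/Z (i.e. R/Z with
    -- Z ≤ R ⊴ X) is transitive or semiregular
    (∀ R : Subgroup (K ⋊[H.subtype] ↥H), R.Normal → Z ≤ R →
      (∀ a b : (K ⋊[H.subtype] ↥H) ⧸ Y, ∃ r ∈ R, r • a = b) ∨
      (∀ r ∈ R, (∃ a : (K ⋊[H.subtype] ↥H) ⧸ Y, r • a = a) → r ∈ Z)) ∧
    -- the point stabiliser of the trivial coset is Y, Y = HZ, and Y/Z ≅ H
    MulAction.stabilizer (K ⋊[H.subtype] ↥H)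
      ((QuotientGroup.mk 1 : (K ⋊[H.subtype] ↥H) ⧸ Y)) = Y ∧
    Y = (SemidirectProduct.inr : ↥H →* K ⋊[H.subtype] ↥H).range ⊔ Z ∧
    (∃ φ : ↥Y →* ↥H, Function.Surjective φ ∧
      ∀ y : ↥Y, φ y = 1 ↔ (y : K ⋊[H.subtype] ↥H) ∈ Z) ∧
    -- KZ/Z is a plinth of X/Z, and KZ/Z ≅ K
    KZ.Normal ∧
    (∀ a b : (K ⋊[H.subtype] ↥H) ⧸ Y, ∃ x ∈ KZ, x • a = b) ∧
    (∀ R : Subgroup (K ⋊[H.subtype] ↥H), R.Normal → Z ≤ R → R < KZ →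
      ¬ ∀ a b : (K ⋊[H.subtype] ↥H) ⧸ Y, ∃ r ∈ R, r • a = b) ∧
    (∃ ψ : ↥KZ →* K, Function.Surjective ψ ∧
      ∀ x : ↥KZ, ψ x = 1 ↔ (x : K ⋊[H.subtype] ↥H) ∈ Z) ∧
    -- KZ/Z ∩ HZ/Z = LZ/Z ≅ L
    KZ ⊓ Y = LZ ∧
    (∃ χ : ↥LZ →* ↥L, Function.Surjective χ ∧
      ∀ x : ↥LZ, χ x = 1 ↔ (x : K ⋊[H.subtype] ↥H) ∈ Z) := by
  have hYmem : ∀ x, x ∈ Y ↔ x.left ∈ L := fun x => hY ▸ mem_map_inl_sup_range_inr hLH x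
  have hZn : Z.Normal := normal_of_mem_iff_conj hLH hZ
  have hZY : Z ≤ Y := fun x hx => (hYmem x).2 ((hZ x).1 hx).1
  have hinrY : ∀ h, inr h ∈ Y := fun h => (hYmem _).2 L.one_mem
  have hinlZ : ∀ k, inl k ∈ Z → k = 1 := fun k hk => eq_one_of_inl_mem hLcf hZ hk
  have hKKZ : ∀ k, inl k ∈ KZ := fun k => hKZ ▸ Subgroup.mem_sup_left ⟨k, rfl⟩
  have hdecomp : ∀ x ∈ Y, ∃ h : ↥H, ∃ z ∈ Z, z * inr h = x := fun x hx =>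
    exists_inr_mul_eq hLK0 hZ ((hYmem x).1 hx)
  have hinrZ : ∀ h : ↥H, inr h ∈ Z → h = 1 := by
    intro h hh
    ext k
    simpa using ((hZ _).1 hh).2 k
  have hYH : Y = (inr : ↥H →* K ⋊[H.subtype] ↥H).range ⊔ Z := by
    refine le_antisymm (fun x hx => ?_) (sup_le ?_ hZY)
    · obtain ⟨h, z, hz, rfl⟩ := hdecomp x hx
      exact Subgroup.mul_mem _ (Subgroup.mem_sup_right hz) (Subgroup.mem_sup_left ⟨h, rfl⟩)
    · rintro _ ⟨h, rfl⟩
      exact hinrY h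
  -- a normal subgroup with proper trace on `K` meets `Y` inside `Z`
  have hmeet : ∀ R : Subgroup (K ⋊[H.subtype] ↥H), R.Normal → Z ≤ R →
      R.comap (inl : K →* K ⋊[H.subtype] ↥H) < ⊤ → ∀ x ∈ R, x ∈ Y → x ∈ Z := by
    intro R hR hZR hlt x hxR hxY
    obtain ⟨h, z, hz, rfl⟩ := hdecomp x hxY
    have hh : inr h ∈ R := (Subgroup.mul_mem_cancel_left R (hZR hz)).1 hxR
    have h1 : (h : MulAut K) = 1 := hfaith _ inferInstance
      (fun g hg k hk => apply_mem_comap_inl R hg hk) hlt h h.2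
      (apply_mul_inv_mem_comap_inl R hh)
    rw [Subtype.ext h1 (a2 := (1 : ↥H)), map_one, mul_one]
    exact hz
  have htrans : ∀ R : Subgroup (K ⋊[H.subtype] ↥H), (∀ k, inl k ∈ R) →
      ∀ a b : (K ⋊[H.subtype] ↥H) ⧸ Y, ∃ r ∈ R, r • a = b := by
    intro R hR
    refine (Subgroup.forall_exists_smul_eq_iff R Y).2 fun x => ⟨inl x.left, hR _, ?_⟩
    have hx : (inl x.left)⁻¹ * x = inr x.right :=
      inv_mul_eq_of_eq_mul (inl_left_mul_inr_right x).symm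
    exact hx ▸ hinrY x.right
  refine ⟨?_, ?_, ?_, ?_, ?_, ?_, ?_, htrans KZ hKKZ, ?_, ?_, ?_, ?_⟩
  · refine le_antisymm (Subgroup.normal_le_normalCore.2 hZY) fun x hx => ?_
    obtain ⟨h, z, hz, rfl⟩ := hdecomp x (Y.normalCore_le hx)
    have hh : inr h ∈ Y.normalCore := (Subgroup.mul_mem_cancel_left _
      (Subgroup.normal_le_normalCore.2 hZY hz)).1 hx
    have hbot : Y.normalCore.comap (inl : K →* K ⋊[H.subtype] ↥H) ≤ ⊥ := by
      rw [← hLcf, Subgroup.normal_le_normalCore]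
      exact fun k hk => (hYmem _).1 (Y.normalCore_le hk)
    have h1 : (h : MulAut K) = 1 := by
      ext k
      exact mul_inv_eq_one.1
        (Subgroup.mem_bot.1 (hbot (apply_mul_inv_mem_comap_inl _ hh k)))
    rw [Subtype.ext h1 (a2 := (1 : ↥H)), map_one, mul_one]
    exact hz
  · exact fun a b => MulAction.exists_smul_eq _ a b
  · intro R hR hZR
    by_cases hlt : R.comap (inl : K →* K ⋊[H.subtype] ↥H) = ⊤
    · exact Or.inl (htrans R fun k => Subgroup.mem_comap.1 (hlt ▸ Subgroup.mem_top k))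
    · refine Or.inr fun r hr => ?_
      rintro ⟨a, ha⟩
      obtain ⟨x, rfl⟩ := QuotientGroup.mk_surjective a
      have hxY : x⁻¹ * r * x ∈ Y := by
        rw [MulAction.Quotient.smul_mk] at ha
        simpa [mul_assoc] using QuotientGroup.eq.1 ha.symm
      have hxR : x⁻¹ * r * x ∈ R := by simpa using hR.conj_mem r hr x⁻¹
      have := hZn.conj_mem _ (hmeet R hR hZR (lt_top_iff_ne_top.2 hlt) _ hxR hxY) x
      simpa [mul_assoc] using this
  · exact MulAction.stabilizer_quotient Y
  · exact hYH
  · exact inr.exists_surjective_of_range_sup Z hinrZ Y hYH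
  · rw [hKZ, range_inl_eq_ker_rightHom]
    infer_instance
  · intro R hR hZR hlt htr
    rw [Subgroup.forall_exists_smul_eq_iff] at htr
    refine hnogen (R.comap inl) inferInstance (fun g hg k hk => apply_mem_comap_inl R hg hk)
      (lt_top_iff_ne_top.2 fun htop => hlt.not_ge ?_) (eq_top_iff.2 fun k _ => ?_)
    · rw [hKZ]
      refine sup_le ?_ hZR
      rintro _ ⟨k, rfl⟩
      exact Subgroup.mem_comap.1 (htop ▸ Subgroup.mem_top k)
    · obtain ⟨r, hr, hrk⟩ := htr (inl k)
      obtain ⟨_, ⟨m, rfl⟩, z, hz, rfl⟩ :=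
        Subgroup.mem_sup_of_normal_right.1 (hKZ ▸ hlt.le hr)
      have hm : m ∈ R.comap (inl : K →* K ⋊[H.subtype] ↥H) :=
        (Subgroup.mul_mem_cancel_right R (hZR hz)).1 hr
      have hl : m⁻¹ * k ∈ L := by
        have := Y.mul_mem (hZY hz) hrk
        rw [mul_inv_rev, mul_assoc, mul_inv_cancel_left, ← map_inv, ← map_mul] at this
        exact (hYmem _).1 this
      rw [← mul_inv_cancel_left m k]
      exact Subgroup.mul_mem _ (Subgroup.mem_sup_right hm) (Subgroup.mem_sup_left hl)
  · exact inl.exists_surjective_of_range_sup Z hinlZ KZ hKZ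
  · refine le_antisymm ?_ ?_
    · rintro x ⟨hxK, hxY⟩
      obtain ⟨_, ⟨k, rfl⟩, z, hz, rfl⟩ := Subgroup.mem_sup_of_normal_right.1 (hKZ ▸ hxK)
      have hk : inl k ∈ Y := (Subgroup.mul_mem_cancel_right Y (hZY hz)).1 hxY
      rw [hLZ]
      exact Subgroup.mul_mem _ (Subgroup.mem_sup_left ⟨k, (hYmem _).1 hk, rfl⟩)
        (Subgroup.mem_sup_right hz)
    · rw [hLZ]
      refine sup_le ?_ (le_inf (hKZ ▸ le_sup_right) hZY)
      rintro _ ⟨l, hl, rfl⟩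
      exact ⟨hKKZ l, (hYmem _).2 hl⟩
  · refine (inl.comp L.subtype).exists_surjective_of_range_sup Z
      (fun l hl => Subtype.ext (hinlZ l hl)) LZ ?_
    rw [hLZ, MonoidHom.range_comp, Subgroup.range_subtype]
end
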